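/- Let F = (f₁,…,f_p) ∈ ℤ[X₁,…,X_n]^p with deg f_j ≤ d for all j, such that the ideal ⟨f₁,…,f_p⟩ ⊆ ℂ[X₁,…,X_n] is radical, every minimal prime over ⟨f₁,…,f_p⟩ has height p, and jac(F)(x) has rank p at every x ∈ V(F). Let 𝔄 be an n×n matrix of independent indeterminates, K = ℂ(𝔄_{k,m} : 1≤k,m≤n), F^𝔄 = (f₁(𝔄X),…,f_p(𝔄X)) ∈ K[X₁,…,X_n]^p, fix i ∈ {1,…,n−p+1}, and let 𝒦 be the ideal generated by 𝔍(i,F^𝔄) in K[X₁,…,X_n]. Then for each j ∈ {i,…,n} there exists a polynomial P_j ∈ K[X₁,…,X_{i−1},X_j], monic as a polynomial in X_j, with P_j ∈ √𝒦, together with a nonzero polynomial D ∈ ℂ[𝔄_{k,m} : 1≤k,m≤n] clearing all denominators of the coefficients of P_j, such that D·P_j, viewed as a polynomial in ℂ[𝔄_{k,m}, X₁,…,X_{i−1},X_j], has total degree at most (2d)^{2n}. -/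

import Mathlib

open MvPolynomial

noncomputable section

/-- The Jacobian matrix, evaluated at a point. -/
def jacEval {ι σ : Type*} [Fintype ι] [Fintype σ]
    (G : ι → MvPolynomial σ ℂ) (y : σ → ℂ) : Matrix ι σ ℂ :=
  Matrix.of fun j k => eval y (pderiv k (G j))

/-- The ideal `P` is prime of height `c`. -/
def IdealHeightEq {R : Type*} [CommRing R] (P : Ideal R) (c : ℕ) : Prop :=
  ∃ hP : P.IsPrime, Order.height (⟨P, hP⟩ : PrimeSpectrum R) = (c : ℕ∞)

/-- The complexification of an integer polynomial. -/
def toC {n : ℕ} (f : MvPolynomial (Fin n) ℤ) : MvPolynomial (Fin n) ℂ :=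
  map (Int.castRingHom ℂ) f

/-- `K = ℂ(𝔄_{k,m})`, the field of rational functions in the `n²` entries of a
generic `n × n` matrix `𝔄`. -/
abbrev GenField (n : ℕ) : Type :=
  FractionRing (MvPolynomial (Fin n × Fin n) ℂ)

/-- The generic-matrix entry `𝔄_{k,m}` as an element of `K`. -/
def genEntry (n : ℕ) (k m : Fin n) : GenField n :=
  algebraMap (MvPolynomial (Fin n × Fin n) ℂ) (GenField n) (X (k, m))

/-- `f^𝔄 = f(𝔄·X) ∈ K[X₁,…,X_n]` for an integer polynomial `f`. -/
def genChange {n : ℕ} (f : MvPolynomial (Fin n) ℤ) : MvPolynomial (Fin n) (GenField n) :=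
  aeval (fun k : Fin n => ∑ m : Fin n, C (genEntry n k m) * X m)
    (map (Int.castRingHom (GenField n)) f)

/-- The index (as an element of `Fin n`) of the `c`-th of the last `n - i` variables. -/
def colIdx (n i : ℕ) (c : Fin (n - i)) : Fin n :=
  ⟨i + c, by have := c.isLt; omega⟩

/-- The ideal `⟨𝔍(i,G)⟩` generated by `G` and the `p × p` minors of `jac(G, i)`. -/
def polarIdealK {R : Type*} [CommRing R] {n p : ℕ}
    (G : Fin p → MvPolynomial (Fin n) R) (i : ℕ) : Ideal (MvPolynomial (Fin n) R) :=
  Ideal.span (Set.range G ∪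
    {g | ∃ c : Fin p ↪ Fin (n - i),
      g = Matrix.det (Matrix.of fun a b : Fin p => pderiv (colIdx n i (c b)) (G a))})

/-- The interpretation ring homomorphism from `ℂ[𝔄_{k,m}, X₁,…,X_{i−1}, X_j]`
(with variable set `(Fin n × Fin n) ⊕ (Fin (i−1) ⊕ Unit)`) to `K[X₁,…,X_{i−1}][X_j]`,
sending `𝔄_{k,m}` to the corresponding element of `K`, the first block of `X`'s to the
coefficient variables, and the last variable to `X_j`. -/
def interp (n i : ℕ) :
    MvPolynomial ((Fin n × Fin n) ⊕ (Fin (i - 1) ⊕ Unit)) ℂ →+*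
      Polynomial (MvPolynomial (Fin (i - 1)) (GenField n)) :=
  eval₂Hom
    (Polynomial.C.comp ((C : GenField n →+* MvPolynomial (Fin (i - 1)) (GenField n)).comp
      ((algebraMap (MvPolynomial (Fin n × Fin n) ℂ) (GenField n)).comp
        (C : ℂ →+* MvPolynomial (Fin n × Fin n) ℂ))))
    (Sum.elim
      (fun km : Fin n × Fin n => Polynomial.C (C (genEntry n km.1 km.2)))
      (Sum.elim (fun t : Fin (i - 1) => Polynomial.C (X t)) (fun _ => Polynomial.X)))

/-- The number of exponents of total degree at most `D`. -/
def monomialCount (σ : Type*) (D : ℕ) : ℕ := Nat.card {x : σ →₀ ℕ // x.degree ≤ D}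

instance finite_degree_le (σ : Type*) [Finite σ] (D : ℕ) :
    Finite {x : σ →₀ ℕ // x.degree ≤ D} :=
  (Finsupp.finite_of_degree_le (σ := σ) D).to_subtype

lemma monomialCount_mono_degree (σ : Type*) [Finite σ] {D D' : ℕ} (h : D ≤ D') :
    monomialCount σ D ≤ monomialCount σ D' :=
  Nat.card_le_card_of_injective
    (fun x : {x : σ →₀ ℕ // x.degree ≤ D} => (⟨x.1, x.2.trans h⟩ : {x : σ →₀ ℕ // x.degree ≤ D'}))
    fun x y hxy => Subtype.ext (by simpa using hxy)

lemma monomialCount_le_of_embedding {σ τ : Type*} [Finite τ] (f : σ ↪ τ) (D : ℕ) :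
    monomialCount σ D ≤ monomialCount τ D :=
  Nat.card_le_card_of_injective
    (fun x : {x : σ →₀ ℕ // x.degree ≤ D} =>
      (⟨x.1.mapDomain f, by rw [Finsupp.degree_mapDomain]; exact x.2⟩ :
        {x : τ →₀ ℕ // x.degree ≤ D}))
    fun x y hxy => Subtype.ext (Finsupp.mapDomain_injective f.injective (by simpa using hxy))

lemma one_le_monomialCount (σ : Type*) [Finite σ] (D : ℕ) : 1 ≤ monomialCount σ D := by
  have : Nonempty {x : σ →₀ ℕ // x.degree ≤ D} := ⟨⟨0, by simp⟩⟩
  exact Nat.card_pos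

lemma monomialCount_le_pow (σ : Type*) [Fintype σ] (D : ℕ) :
    monomialCount σ D ≤ (D + 1) ^ Fintype.card σ := by
  classical
  have h := Nat.card_le_card_of_injective
    (fun (x : {x : σ →₀ ℕ // x.degree ≤ D}) (s : σ) =>
      (⟨x.1 s, Nat.lt_succ_of_le ((Finsupp.le_degree s x.1).trans x.2)⟩ : Fin (D + 1)))
    (fun x y hxy => Subtype.ext (Finsupp.ext fun s => by simpa using congrFun hxy s))
  rwa [Nat.card_eq_fintype_card (α := σ → Fin (D + 1)), Fintype.card_fun, Fintype.card_fin] at h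

lemma sum_monomialCount_le (σ : Type*) [Fintype σ] (V : ℕ) :
    ∑ v ∈ Finset.range (V + 1), monomialCount σ v ≤ monomialCount (Option σ) V := by
  have hc : ∑ v ∈ Finset.range (V + 1), monomialCount σ v =
      Nat.card (Σ v : Fin (V + 1), {x : σ →₀ ℕ // x.degree ≤ v}) := by
    rw [Nat.card_sigma, Finset.sum_range]; rfl
  rw [hc]
  refine Nat.card_le_card_of_injective (fun s =>
    (⟨Finsupp.equivFunOnFinite.symm (fun o => Option.elim o (V - s.1) s.2.1), ?_⟩ :
      {x : Option σ →₀ ℕ // x.degree ≤ V})) ?_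
  · have h1 := s.2.2
    have h2 := s.1.2
    rw [Finsupp.degree_eq_sum] at h1 ⊢
    simp only [Fintype.sum_option, Finsupp.equivFunOnFinite_symm_apply_apply, Option.elim]
    omega
  · rintro ⟨v, x, hx⟩ ⟨w, y, hy⟩ h
    have h' := Finsupp.equivFunOnFinite.symm.injective (Subtype.ext_iff.1 h)
    have hvw : v = w := by
      have := congrFun h' none
      simp only [Option.elim] at this
      ext; omega
    subst hvw
    have hxy : x = y := Finsupp.ext fun s => by simpa using congrFun h' (some s)
    subst hxy
    rfl

/-- The number of exponents `(a, t)` with `|a| + e |t| ≤ D`. -/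
def weightedCount (τ ι : Type*) (e D : ℕ) : ℕ :=
  Nat.card {s : (τ →₀ ℕ) × (ι →₀ ℕ) // s.1.degree + e * s.2.degree ≤ D}

/-- The number of exponents `(a, t)` with `|a| + e |t| ≤ D` and `a` not above `α`. -/
def restrictedCount (τ ι : Type*) (e : ℕ) (α : τ →₀ ℕ) (D : ℕ) : ℕ :=
  Nat.card {s : (τ →₀ ℕ) × (ι →₀ ℕ) // s.1.degree + e * s.2.degree ≤ D ∧ ¬ α ≤ s.1}

lemma finite_weighted (τ ι : Type*) [Finite τ] [Finite ι] {e : ℕ} (he : 0 < e) (D : ℕ) :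
    Finite {s : (τ →₀ ℕ) × (ι →₀ ℕ) // s.1.degree + e * s.2.degree ≤ D} := by
  refine Finite.of_injective (β := {x : τ →₀ ℕ // x.degree ≤ D} × {x : ι →₀ ℕ // x.degree ≤ D})
    (fun s => (⟨s.1.1, by have := s.2; omega⟩, ⟨s.1.2, by have := s.2; nlinarith⟩)) ?_
  rintro ⟨⟨a, t⟩, h⟩ ⟨⟨a', t'⟩, h'⟩ hh
  simpa using hh

lemma finite_restricted (τ ι : Type*) [Finite τ] [Finite ι] {e : ℕ} (he : 0 < e)
    (α : τ →₀ ℕ) (D : ℕ) :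
    Finite {s : (τ →₀ ℕ) × (ι →₀ ℕ) // s.1.degree + e * s.2.degree ≤ D ∧ ¬ α ≤ s.1} := by
  have := finite_weighted τ ι he D
  refine Finite.of_injective
    (β := {s : (τ →₀ ℕ) × (ι →₀ ℕ) // s.1.degree + e * s.2.degree ≤ D})
    (fun s => ⟨s.1, s.2.1⟩) ?_
  rintro ⟨s, h⟩ ⟨s', h'⟩ hh
  simpa using hh

lemma monomialCount_le_weightedCount (τ ι : Type*) [Fintype τ] [Fintype ι] {e : ℕ} (he : 0 < e)
    (D : ℕ) :
    monomialCount (τ ⊕ ι) D ≤ weightedCount τ ι e D * e ^ Fintype.card ι := by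
  classical
  have := finite_weighted τ ι he D
  have h := Nat.card_le_card_of_injective
    (β := {s : (τ →₀ ℕ) × (ι →₀ ℕ) // s.1.degree + e * s.2.degree ≤ D} × (ι → Fin e))
    (fun x : {x : τ ⊕ ι →₀ ℕ // x.degree ≤ D} =>
      (⟨(Finsupp.equivFunOnFinite.symm fun a => x.1 (Sum.inl a),
          Finsupp.equivFunOnFinite.symm fun b => x.1 (Sum.inr b) / e), by
          have hx := x.2
          rw [Finsupp.degree_eq_sum, Fintype.sum_sum_type] at hx
          simp only [Finsupp.degree_eq_sum, Finsupp.equivFunOnFinite_symm_apply_apply,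
            Finset.mul_sum]
          refine le_trans (Nat.add_le_add_left (Finset.sum_le_sum fun b _ => ?_) _) hx
          exact Nat.mul_div_le _ _⟩,
        fun b => ⟨x.1 (Sum.inr b) % e, Nat.mod_lt _ he⟩))
    (by
      rintro ⟨x, hx⟩ ⟨y, hy⟩ h
      simp only [Prod.mk.injEq, Subtype.mk.injEq, EmbeddingLike.apply_eq_iff_eq] at h
      refine Subtype.ext (Finsupp.ext fun s => ?_)
      rcases s with a | b
      · exact congrFun h.1.1 a
      · have h1 := congrFun h.1.2 b
        have h2 : x (Sum.inr b) % e = y (Sum.inr b) % e := by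
          simpa using congrFun h.2 b
        simp only at h1 ⊢
        rw [← Nat.div_add_mod (x (Sum.inr b)) e, h1, h2, Nat.div_add_mod])
  rwa [Nat.card_prod, Nat.card_eq_fintype_card (α := ι → Fin e), Fintype.card_fun,
    Fintype.card_fin] at h

lemma weightedCount_add_le (τ ι : Type*) [Finite τ] [Finite ι] {e : ℕ} (he : 0 < e)
    (α : τ →₀ ℕ) (D : ℕ) :
    weightedCount τ ι e (D + α.degree) ≤
      restrictedCount τ ι e α (D + α.degree) + weightedCount τ ι e D := by
  classical
  have := finite_weighted τ ι he D
  have := finite_restricted τ ι he α (D + α.degree)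
  rw [restrictedCount, weightedCount, weightedCount, ← Nat.card_sum]
  have key : ∀ a : τ →₀ ℕ, α ≤ a → (a - α).degree + α.degree = a.degree := fun a ha => by
    rw [← map_add, tsub_add_cancel_of_le ha]
  refine Nat.card_le_card_of_injective (fun s => if h : α ≤ s.1.1 then
    Sum.inr ⟨(s.1.1 - α, s.1.2), by have := s.2; have := key _ h; dsimp only; omega⟩
    else Sum.inl ⟨s.1, s.2, h⟩) ?_
  rintro ⟨⟨a, t⟩, h⟩ ⟨⟨a', t'⟩, h'⟩ hh
  by_cases h1 : α ≤ a <;> by_cases h2 : α ≤ a' <;> simp [h1, h2] at hh ⊢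
  · refine ⟨?_, hh.2⟩
    rw [← tsub_add_cancel_of_le h1, hh.1, tsub_add_cancel_of_le h2]
  · exact hh

lemma weightedCount_le_of_lt (τ ι : Type*) [Finite τ] [Finite ι] {e : ℕ} (he : 0 < e)
    (α : τ →₀ ℕ) (D : ℕ) (hD : D < α.degree) :
    weightedCount τ ι e D ≤ restrictedCount τ ι e α D := by
  have := finite_restricted τ ι he α D
  refine Nat.card_le_card_of_injective (fun s => ⟨s.1, s.2, fun h => ?_⟩) ?_
  · have h1 := Finsupp.degree_mono h
    have h2 := s.2
    omega
  · rintro ⟨s, h⟩ ⟨s', h'⟩ hh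
    simpa using hh

/-- Monomial counting: if the restricted weighted count is dominated by the number of monomials
in too few variables, then the forbidden exponent has degree at most `e ^ |ι|`. -/
lemma degree_le_of_restrictedCount_le {σ τ ι : Type*} [Fintype σ] [Fintype τ] [Fintype ι]
    {e : ℕ} (he : 0 < e) (hcard : Fintype.card σ + 1 ≤ Fintype.card τ + Fintype.card ι)
    (α : τ →₀ ℕ) (h : ∀ D, restrictedCount τ ι e α D ≤ monomialCount σ D) :
    α.degree ≤ e ^ Fintype.card ι := by
  by_contra! hlt
  set E := α.degree with hE
  set q := e ^ Fintype.card ι with hq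
  have hEpos : 0 < E := by omega
  have hA : ∀ M, weightedCount τ ι e (M * E) ≤
      ∑ m ∈ Finset.range (M + 1), monomialCount σ (m * E) := by
    intro M
    induction M with
    | zero =>
      simpa using (weightedCount_le_of_lt τ ι he α 0 hEpos).trans (h 0)
    | succ M ih =>
      rw [Finset.sum_range_succ, Nat.succ_mul]
      have h1 := weightedCount_add_le τ ι he α (M * E)
      rw [← hE] at h1
      have := h (M * E + E)
      omega
  have hB : ∀ M, E * ∑ m ∈ Finset.range (M + 1), monomialCount σ (m * E) ≤
      ∑ v ∈ Finset.range ((M + 1) * E), monomialCount σ v := by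
    intro M
    induction M with
    | zero =>
      simp only [zero_add, Finset.sum_range_one, zero_mul, one_mul]
      calc E * monomialCount σ 0 = ∑ v ∈ Finset.range E, monomialCount σ 0 := by simp
        _ ≤ _ := Finset.sum_le_sum fun v _ => monomialCount_mono_degree σ (Nat.zero_le v)
    | succ M ih =>
      rw [Finset.sum_range_succ, mul_add, Nat.succ_mul (M + 1),
        Finset.sum_range_add _ ((M + 1) * E) E]
      refine Nat.add_le_add ih ?_
      calc E * monomialCount σ ((M + 1) * E)
          = ∑ v ∈ Finset.range E, monomialCount σ ((M + 1) * E) := by simp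
        _ ≤ _ := Finset.sum_le_sum fun v _ => monomialCount_mono_degree σ (Nat.le_add_right _ v)
  have hemb : Nonempty (Option σ ↪ τ ⊕ ι) :=
    Function.Embedding.nonempty_of_card_le (by simpa using hcard)
  obtain ⟨emb⟩ := hemb
  set c : ℕ → ℕ := fun M => monomialCount (τ ⊕ ι) (M * E) with hc
  have hstep : ∀ M, (q + 1) * c M ≤ q * c (M + 1) := by
    intro M
    have h1 := monomialCount_le_weightedCount τ ι he (M * E)
    have h2 : ∑ v ∈ Finset.range ((M + 1) * E), monomialCount σ v ≤ c (M + 1) := by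
      have h3 := sum_monomialCount_le σ ((M + 1) * E - 1)
      rw [Nat.sub_add_cancel (by nlinarith)] at h3
      exact (h3.trans (monomialCount_le_of_embedding emb _)).trans
        (monomialCount_mono_degree _ (Nat.sub_le _ _))
    calc (q + 1) * c M ≤ E * c M := Nat.mul_le_mul_right _ hlt
      _ ≤ E * (weightedCount τ ι e (M * E) * q) := Nat.mul_le_mul_left _ h1
      _ = q * (E * weightedCount τ ι e (M * E)) := by ring
      _ ≤ q * c (M + 1) := Nat.mul_le_mul_left _
        (((Nat.mul_le_mul_left _ (hA M)).trans (hB M)).trans h2)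
  have hqpos : 0 < q := pow_pos he _
  have hgrow : ∀ M : ℕ, ((q + 1 : ℝ) / q) ^ M ≤ c M := by
    intro M
    induction M with
    | zero => simpa [hc] using one_le_monomialCount (τ ⊕ ι) 0
    | succ M ih =>
      have h1 : ((q : ℝ) + 1) * c M ≤ q * c (M + 1) := by exact_mod_cast hstep M
      have hq' : (0 : ℝ) < q := by exact_mod_cast hqpos
      rw [pow_succ]
      calc ((q + 1 : ℝ) / q) ^ M * ((q + 1) / q) ≤ c M * ((q + 1) / q) := by gcongr
        _ = ((q + 1) * c M) / q := by ring
        _ ≤ c (M + 1) := by rw [div_le_iff₀ hq']; linarith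
  have hpoly : ∀ M : ℕ, (c M : ℝ) ≤ (M * E + 1 : ℝ) ^ Fintype.card (τ ⊕ ι) := fun M => by
    exact_mod_cast monomialCount_le_pow (τ ⊕ ι) (M * E)
  set k := Fintype.card (τ ⊕ ι)
  have hr : 1 < (q + 1 : ℝ) / q := by
    have hq' : (0 : ℝ) < q := by exact_mod_cast hqpos
    rw [lt_div_iff₀ hq']; linarith
  have hlim := tendsto_pow_const_div_const_pow_of_one_lt k hr
  have hev := hlim.eventually (gt_mem_nhds (show (0 : ℝ) < 1 / (2 * E) ^ k by positivity))
  obtain ⟨M, hM, hM1⟩ := (hev.and (Filter.eventually_ge_atTop 1)).exists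
  have hp : (0 : ℝ) < ((q + 1 : ℝ) / q) ^ M := by positivity
  rw [div_lt_div_iff₀ hp (by positivity), one_mul, ← mul_pow] at hM
  have h1 : (M * E + 1 : ℝ) ^ k ≤ (M * (2 * E)) ^ k := by
    have hM1' : (1 : ℝ) ≤ M := by exact_mod_cast hM1
    have hE1 : (1 : ℝ) ≤ E := by exact_mod_cast hEpos
    gcongr
    nlinarith
  linarith [hgrow M, hpoly M]

/-- A zero `ξ` of the polynomials `g` at which the differential of `g` is surjective; the
differential is read off as the linear coefficient along lines through `ξ`. -/
def IsSmoothZero {k σ ι L : Type*} [Field k] [Field L] [Algebra k L]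
    (g : ι → MvPolynomial σ k) (ξ : σ → L) : Prop :=
  (∀ j, aeval ξ (g j) = 0) ∧ ∀ w : ι → L, ∃ v : σ → L, ∀ j,
    (aeval (fun s => Polynomial.C (ξ s) + Polynomial.C (v s) * Polynomial.X) (g j)).coeff 1 = w j

lemma coeff_zero_aeval_line {k σ L : Type*} [Field k] [Field L] [Algebra k L]
    (ξ v : σ → L) (P : MvPolynomial σ k) :
    (aeval (fun s => Polynomial.C (ξ s) + Polynomial.C (v s) * Polynomial.X) P).coeff 0 =
      aeval ξ P := by
  have : (Polynomial.aeval (0 : L)).restrictScalars k (aeval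
      (fun s => Polynomial.C (ξ s) + Polynomial.C (v s) * Polynomial.X) P) = aeval ξ P := by
    rw [← AlgHom.comp_apply, comp_aeval]
    congr 2
    funext s
    simp
  rw [← this]
  simp [Polynomial.coeff_zero_eq_eval_zero, Polynomial.aeval_def, Polynomial.eval₂_eq_eval_map]

lemma aeval_coeff_eq_zero_of_isSmoothZero {k σ τ ι L : Type*} [Field k] [Field L] [Algebra k L]
    [Infinite L] [Finite ι] {g : ι → MvPolynomial σ k} {ξ : σ → L} (hξ : IsSmoothZero g ξ)
    (z : τ → σ) (Q : MvPolynomial ι (MvPolynomial τ k))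
    (hQ : eval₂Hom (rename z).toRingHom g Q = 0) (t : ι →₀ ℕ)
    (ht : ∀ t' : ι →₀ ℕ, t'.degree < t.degree → Q.coeff t' = 0) :
    aeval (ξ ∘ z) (Q.coeff t) = 0 := by
  classical
  have := Fintype.ofFinite ι
  set ψ : MvPolynomial τ k →+* L := (aeval (ξ ∘ z) : MvPolynomial τ k →ₐ[k] L).toRingHom with hψ
  have key : homogeneousComponent t.degree (map ψ Q) = 0 := by
    refine funext fun w => ?_
    obtain ⟨v, hv⟩ := hξ.2 w
    set φ : MvPolynomial σ k →ₐ[k] Polynomial L :=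
      aeval (fun s => Polynomial.C (ξ s) + Polynomial.C (v s) * Polynomial.X) with hφ
    have hφ0 : ∀ P, (φ P).coeff 0 = aeval ξ P := coeff_zero_aeval_line ξ v
    have hh : ∀ j, ∃ h : Polynomial L, φ (g j) = Polynomial.X * h ∧ h.coeff 0 = w j := by
      intro j
      obtain ⟨h, hh⟩ := Polynomial.X_dvd_iff.2 ((hφ0 (g j)).trans (hξ.1 j))
      exact ⟨h, hh, by rw [← hv j, hh, Polynomial.coeff_X_mul]⟩
    choose h hh1 hh2 using hh
    have h0 : φ (eval₂Hom (rename z).toRingHom g Q) = 0 := by rw [hQ, map_zero]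
    rw [coe_eval₂Hom, eval₂_eq', map_sum] at h0
    have h1 := congrArg (fun P => Polynomial.coeff P t.degree) h0
    simp only [Polynomial.finsetSum_coeff, Polynomial.coeff_zero] at h1
    rw [homogeneousComponent_apply, map_sum, map_zero]
    have hterm : ∀ t' ∈ Q.support,
        (φ ((rename z).toRingHom (coeff t' Q) * ∏ i, g i ^ t' i)).coeff t.degree =
        if t'.degree = t.degree then ψ (coeff t' Q) * ∏ i, w i ^ t' i else 0 := by
      intro t' ht'
      have e1 : φ ((rename z).toRingHom (coeff t' Q) * ∏ i, g i ^ t' i) =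
          Polynomial.X ^ t'.degree * (φ (rename z (coeff t' Q)) * ∏ i, h i ^ t' i) := by
        rw [map_mul, map_prod]
        simp only [map_pow, hh1, mul_pow, Finset.prod_mul_distrib, Finset.prod_pow_eq_pow_sum]
        rw [← Finsupp.degree_eq_sum]
        change φ (rename z (coeff t' Q)) * _ = _
        ring
      rw [e1, Polynomial.coeff_X_pow_mul']
      rcases lt_trichotomy t'.degree t.degree with hlt | heq | hgt
      · exact absurd (ht t' hlt) (mem_support_iff.1 ht')
      · rw [if_pos heq.le, if_pos heq, heq, Nat.sub_self, Polynomial.mul_coeff_zero, hφ0,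
          aeval_rename, Polynomial.coeff_zero_prod]
        congr 1
        refine Finset.prod_congr rfl fun i _ => ?_
        rw [Polynomial.coeff_zero_eq_eval_zero, Polynomial.eval_pow,
          ← Polynomial.coeff_zero_eq_eval_zero, hh2]
      · rw [if_neg (by omega), if_neg (by omega)]
    rw [Finset.sum_congr rfl hterm, ← Finset.sum_filter] at h1
    rw [← h1]
    have hsub : {d ∈ (map ψ Q).support | d.degree = t.degree} ⊆
        {d ∈ Q.support | d.degree = t.degree} :=
      Finset.filter_subset_filter _ (support_map_subset _ _)
    rw [← Finset.sum_subset hsub]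
    · refine Finset.sum_congr rfl fun d _ => ?_
      rw [eval_monomial, coeff_map, Finsupp.prod_fintype _ _ (by simp)]
    · intro d hd hd'
      have : coeff d (map ψ Q) = 0 := by
        by_contra hne
        exact hd' (Finset.mem_filter.2 ⟨mem_support_iff.2 hne, (Finset.mem_filter.1 hd).2⟩)
      rw [coeff_map] at this
      rw [this, zero_mul]
  have h2 := congrArg (coeff t) key
  rw [coeff_homogeneousComponent, if_pos rfl, coeff_map, coeff_zero] at h2
  exact h2

/-- If every nonzero polynomial in the variables `z` vanishing at the given smooth zeros has a
monomial above `α`, then `α` has degree at most the product of the degrees of the equations. -/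
theorem degree_le_of_forall_vanishing {k σ τ ι Λ : Type*} [Field k] [Fintype σ] [Fintype τ]
    [Fintype ι] {L : Λ → Type*} [∀ l, Field (L l)] [∀ l, Algebra k (L l)] [∀ l, Infinite (L l)]
    {e : ℕ} (he : 0 < e) (hcard : Fintype.card σ + 1 ≤ Fintype.card τ + Fintype.card ι)
    {g : ι → MvPolynomial σ k} (hg : ∀ j, (g j).totalDegree ≤ e)
    {ξ : ∀ l, σ → L l} (hξ : ∀ l, IsSmoothZero g (ξ l)) (z : τ → σ) (α : τ →₀ ℕ)
    (hα : ∀ b : MvPolynomial τ k, b ≠ 0 → (∀ l, aeval (ξ l ∘ z) b = 0) → ∃ a ∈ b.support, α ≤ a) :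
    α.degree ≤ e ^ Fintype.card ι := by
  classical
  refine degree_le_of_restrictedCount_le (σ := σ) he hcard α fun D => ?_
  set S := {s : (τ →₀ ℕ) × (ι →₀ ℕ) // s.1.degree + e * s.2.degree ≤ D ∧ ¬ α ≤ s.1}
  have : Finite S := finite_restricted τ ι he α D
  have := Fintype.ofFinite S
  set m : S → MvPolynomial σ k := fun s =>
    eval₂Hom (rename z).toRingHom g (monomial s.1.2 (monomial s.1.1 1)) with hm
  have hmdeg : ∀ s, m s ∈ restrictTotalDegree σ k D := by
    intro s
    rw [mem_restrictTotalDegree]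
    have h1 : m s = rename z (monomial s.1.1 1) * ∏ i, g i ^ s.1.2 i := by
      simp only [hm, coe_eval₂Hom, eval₂_monomial]
      rw [Finsupp.prod_fintype _ _ (by simp)]
      rfl
    rw [h1]
    refine (totalDegree_mul _ _).trans (le_trans (Nat.add_le_add ?_ ?_) s.2.1)
    · refine (totalDegree_rename_le _ _).trans ?_
      refine (totalDegree_monomial_le _ _).trans (le_of_eq ?_)
      rfl
    · refine (totalDegree_finsetProd _ _).trans ?_
      rw [Finsupp.degree_eq_sum, Finset.mul_sum]
      refine Finset.sum_le_sum fun i _ => (totalDegree_pow _ _).trans ?_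
      rw [mul_comm]
      exact Nat.mul_le_mul_right _ (hg i)
  have hli : LinearIndependent k m := by
    rw [Fintype.linearIndependent_iff]
    intro c hc
    set Q : MvPolynomial ι (MvPolynomial τ k) :=
      ∑ s : S, monomial s.1.2 (monomial s.1.1 (c s)) with hQdef
    have hQ : eval₂Hom (rename z).toRingHom g Q = 0 := by
      rw [← hc, hQdef, map_sum]
      refine Finset.sum_congr rfl fun s _ => ?_
      simp only [hm, coe_eval₂Hom, eval₂_monomial]
      rw [← smul_mul_assoc]
      congr 1
      change rename z (monomial _ _) = _ • rename z (monomial _ _)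
      rw [← map_smul, smul_monomial, smul_eq_mul, mul_one]
    have hcoeff : ∀ a t, coeff a (coeff t Q) = ∑ s : S, if s.1 = (a, t) then c s else 0 := by
      intro a t
      rw [hQdef, coeff_sum, coeff_sum]
      refine Finset.sum_congr rfl fun s _ => ?_
      rw [coeff_monomial]
      by_cases h1 : s.1.2 = t
      · rw [if_pos h1, coeff_monomial]
        by_cases h2 : s.1.1 = a
        · rw [if_pos h2, if_pos (Prod.ext h2 h1)]
        · rw [if_neg h2, if_neg fun h => h2 (congrArg Prod.fst h)]
      · rw [if_neg h1, if_neg fun h => h1 (congrArg Prod.snd h), coeff_zero]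
    have hQ0 : Q = 0 := by
      by_contra hne
      obtain ⟨t, htm, htmin⟩ := Finset.exists_min_image Q.support (fun t => t.degree)
        (support_nonempty.2 hne)
      have hmin : ∀ t' : ι →₀ ℕ, t'.degree < t.degree → Q.coeff t' = 0 := fun t' ht' => by
        by_contra hh
        exact absurd (htmin t' (mem_support_iff.2 hh)) (not_le.2 ht')
      obtain ⟨a, ha, haα⟩ := hα (Q.coeff t) (mem_support_iff.1 htm)
        (fun l => aeval_coeff_eq_zero_of_isSmoothZero (hξ l) z Q hQ t hmin)
      rw [mem_support_iff, hcoeff] at ha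
      obtain ⟨s, -, hs⟩ := Finset.exists_ne_zero_of_sum_ne_zero ha
      have hs' : s.1 = (a, t) := by
        by_contra hh
        exact hs (if_neg hh)
      exact s.2.2 (by rw [hs']; exact haα)
    intro s
    have := hcoeff s.1.1 s.1.2
    rw [hQ0, coeff_zero, coeff_zero, Finset.sum_eq_single s] at this
    · simpa using this.symm
    · intro s' _ hne
      exact if_neg fun h => hne (Subtype.ext h)
    · simp
  set m' : S → restrictTotalDegree σ k D := fun s => ⟨m s, hmdeg s⟩
  have hli' : LinearIndependent k m' :=
    LinearIndependent.of_comp (restrictTotalDegree σ k D).subtype hli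
  have : Finite {x : σ →₀ ℕ // x.degree ≤ D} := finite_degree_le σ D
  have bas : Module.Basis {x : σ →₀ ℕ // x.degree ≤ D} k (restrictTotalDegree σ k D) :=
    basisRestrictSupport k {x : σ →₀ ℕ | x.degree ≤ D}
  have := Fintype.ofFinite {x : σ →₀ ℕ // x.degree ≤ D}
  have := Module.Finite.of_basis bas
  have h3 := hli'.fintype_card_le_finrank
  rw [Module.finrank_eq_nat_card_basis bas, ← Nat.card_eq_fintype_card] at h3
  exact h3

/-- A smooth zero of a system whose number of equations exceeds the codimension of the variables
`z` satisfies an algebraic relation in the coordinates `z`. -/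
theorem exists_ne_zero_aeval_eq_zero {k σ τ ι L : Type*} [Field k] [Fintype σ] [Fintype τ]
    [Nonempty τ] [Fintype ι] [Field L] [Algebra k L] [Infinite L]
    (hcard : Fintype.card σ + 1 ≤ Fintype.card τ + Fintype.card ι)
    {g : ι → MvPolynomial σ k} {ξ : σ → L} (hξ : IsSmoothZero g ξ) (z : τ → σ) :
    ∃ b : MvPolynomial τ k, b ≠ 0 ∧ aeval (ξ ∘ z) b = 0 := by
  by_contra! hcon
  obtain ⟨t⟩ := ‹Nonempty τ›
  set e := (Finset.univ.sup fun j => (g j).totalDegree) + 1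
  have h := degree_le_of_forall_vanishing (Λ := Unit) (L := fun _ => L) (e := e)
    (Nat.succ_pos _) hcard (g := g)
    (fun j => (Finset.le_sup (f := fun j => (g j).totalDegree) (Finset.mem_univ j)).trans
      (Nat.le_succ _)) (ξ := fun _ => ξ) (fun _ => hξ) z
    (Finsupp.single t (e ^ Fintype.card ι + 1))
    (fun b hb hb' => absurd (hb' ()) (hcon b hb))
  rw [Finsupp.degree_single] at h
  omega

/-- A generator of the vanishing ideal of smooth zeros, in the variables `z`, has degree at most
the product of the degrees of the equations. -/
theorem totalDegree_le_of_forall_dvd {k σ τ ι Λ : Type*} [Field k] [Fintype σ] [Fintype τ]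
    [Fintype ι] {L : Λ → Type*} [∀ l, Field (L l)] [∀ l, Algebra k (L l)] [∀ l, Infinite (L l)]
    {e : ℕ} (he : 0 < e) (hcard : Fintype.card σ + 1 ≤ Fintype.card τ + Fintype.card ι)
    {g : ι → MvPolynomial σ k} (hg : ∀ j, (g j).totalDegree ≤ e)
    {ξ : ∀ l, σ → L l} (hξ : ∀ l, IsSmoothZero g (ξ l)) (z : τ → σ) (P : MvPolynomial τ k)
    (hP : ∀ b : MvPolynomial τ k, (∀ l, aeval (ξ l ∘ z) b = 0) → P ∣ b) :
    P.totalDegree ≤ e ^ Fintype.card ι := by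
  rcases eq_or_ne P 0 with rfl | hP0
  · simp
  let _ : LinearOrder τ := LinearOrder.lift' (Fintype.equivFin τ) (Fintype.equivFin τ).injective
  rw [← MvPolynomial.degree_degLexDegree]
  refine degree_le_of_forall_vanishing he hcard hg hξ z _ fun b hb hb' => ?_
  obtain ⟨c, rfl⟩ := hP b hb'
  refine ⟨MonomialOrder.degLex.degree (P * c), MonomialOrder.degree_mem_support hb, ?_⟩
  rw [MonomialOrder.degree_mul hP0 (right_ne_zero_of_mul hb)]
  exact le_self_add

section DimensionTheory

universe u

/-- Every prime `p` of the `E`-algebra `R` satisfies `N ≤ height p + trdeg (R / p)`. -/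
def DimensionLowerBound (E R : Type u) [Field E] [CommRing R] [Algebra E R] (N : ℕ) : Prop :=
  ∀ (p : Ideal R) (_ : p.IsPrime) (h : ℕ), p.height ≤ h →
    (N : Cardinal.{u}) ≤ h + Algebra.trdeg E (R ⧸ p)

lemma DimensionLowerBound.of_algEquiv {E R S : Type u} [Field E] [CommRing R] [Algebra E R]
    [CommRing S] [Algebra E S] {N : ℕ} (hR : DimensionLowerBound E R N) (e : R ≃ₐ[E] S) :
    DimensionLowerBound E S N := by
  intro p hp h hh
  have hq : (p.comap e.toRingEquiv).IsPrime := Ideal.comap_isPrime _ _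
  have h1 : (p.comap e.toRingEquiv).height = p.height := RingEquiv.height_comap _ _
  have := hR _ hq h (h1 ▸ hh)
  refine this.trans (le_of_eq ?_)
  congr 1
  refine AlgEquiv.trdeg_eq (Ideal.quotientEquivAlg _ _ e ?_)
  change _ = Ideal.map e.toRingEquiv _
  rw [Ideal.map_comap_of_surjective _ e.toRingEquiv.surjective]

open Polynomial in
lemma DimensionLowerBound.polynomial {E R : Type u} [Field E] [CommRing R] [Algebra E R]
    [IsNoetherianRing R] {N : ℕ} (hR : DimensionLowerBound E R N) :
    DimensionLowerBound E R[X] (N + 1) := by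
  intro P hP h hh
  set p : Ideal R := P.comap Polynomial.C with hp
  have hpp : p.IsPrime := Ideal.comap_isPrime _ _
  have hlies : P.LiesOver p := ⟨rfl⟩
  have hle : p.map Polynomial.C ≤ P := Ideal.map_comap_le
  have hmapP : (p.map (Polynomial.C : R →+* R[X])).IsPrime := Ideal.isPrime_map_C_of_isPrime
  have hlies' : (p.map (Polynomial.C : R →+* R[X])).LiesOver p :=
    ⟨le_antisymm Ideal.le_comap_map (Ideal.comap_mono hle)⟩
  have hht : p.height ≤ (p.map (Polynomial.C : R →+* R[X])).height := by
    rw [Ideal.height_eq_height_add_of_liesOver_of_hasGoingDown p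
      (P := p.map (Polynomial.C : R →+* R[X]))]
    exact le_self_add
  rcases eq_or_lt_of_le hle with heq | hlt
  · have h1 := hR p hpp h ((hht.trans_eq (by rw [heq])).trans hh)
    have h2 : Algebra.trdeg E (R ⧸ p) + 1 ≤ Algebra.trdeg E (R[X] ⧸ P) := by
      have e : (R ⧸ p)[X] ≃ₐ[E] (R[X] ⧸ P) := by
        refine AlgEquiv.ofRingEquiv (f := (Ideal.polynomialQuotientEquivQuotientPolynomial p).trans
          (Ideal.quotEquivOfEq heq)) fun x => ?_
        have : algebraMap E (R ⧸ p)[X] x =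
            Polynomial.map (Ideal.Quotient.mk p) (Polynomial.C (algebraMap E R x)) := by
          rw [Polynomial.map_C]; rfl
        rw [this, RingEquiv.trans_apply,
          Ideal.polynomialQuotientEquivQuotientPolynomial_map_mk]
        rfl
      rw [← e.trdeg_eq, ← Polynomial.trdeg_of_isDomain (R := R ⧸ p)]
      exact trdeg_add_le
    calc ((N + 1 : ℕ) : Cardinal.{u}) = N + 1 := by push_cast; rfl
      _ ≤ (h + Algebra.trdeg E (R ⧸ p)) + 1 := by gcongr
      _ = h + (Algebra.trdeg E (R ⧸ p) + 1) := add_assoc _ _ _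
      _ ≤ _ := by gcongr
  · have h1 : p.height + 1 ≤ h :=
      (add_le_add_left hht 1).trans ((Ideal.height_add_one_le_of_lt_of_isPrime hlt).trans hh)
    obtain ⟨h', rfl⟩ : ∃ h', h = h' + 1 := by
      rcases h with _ | h'
      · simp at h1
      · exact ⟨h', rfl⟩
    have h2 : p.height ≤ h' := by
      push_cast at h1
      exact (ENat.add_le_add_iff_right (by simp)).1 h1
    have h3 : Algebra.trdeg E (R ⧸ p) ≤ Algebra.trdeg E (R[X] ⧸ P) := by
      refine trdeg_le_of_injective (Ideal.quotientMapₐ P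
        (Algebra.algHom E R R[X]) le_rfl) ?_
      exact Ideal.quotientMap_injective
    have h4 := hR p hpp h' h2
    calc ((N + 1 : ℕ) : Cardinal.{u}) = N + 1 := by push_cast; rfl
      _ ≤ (h' + Algebra.trdeg E (R ⧸ p)) + 1 := by gcongr
      _ = ((h' + 1 : ℕ) : Cardinal) + Algebra.trdeg E (R ⧸ p) := by push_cast; ring
      _ ≤ _ := by gcongr

lemma dimensionLowerBound_mvPolynomial (E σ : Type u) [Field E] [Finite σ] :
    DimensionLowerBound E (MvPolynomial σ E) (Nat.card σ) := by
  induction σ using Finite.induction_empty_option with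
  | of_equiv e H =>
    rw [← Nat.card_congr e]
    exact H.of_algEquiv (renameEquiv E e)
  | h_empty => intro p hp h hh; simp
  | h_option IH =>
    rw [Finite.card_option]
    exact IH.polynomial.of_algEquiv (optionEquivLeft _ _).symm

/-- The dimension inequality: a component of the zero set of `r` polynomials in `m` variables
over a field has dimension at least `m - r`. -/
theorem card_le_add_trdeg_of_mem_minimalPrimes {E σ ι : Type u} [Field E] [Finite σ] [Finite ι]
    (g : ι → MvPolynomial σ E) (p : Ideal (MvPolynomial σ E))
    (hp : p ∈ (Ideal.span (Set.range g)).minimalPrimes) :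
    (Nat.card σ : Cardinal.{u}) ≤ Nat.card ι + Algebra.trdeg E (MvPolynomial σ E ⧸ p) := by
  refine dimensionLowerBound_mvPolynomial E σ p hp.1.1 _ ?_
  refine (Ideal.height_le_card_of_mem_minimalPrimes_span (Set.finite_range g) hp).trans ?_
  rw [Nat.cast_le, ← Nat.card_coe_set_eq]
  exact Finite.card_range_le g

end DimensionTheory

section System

variable {n p : ℕ} {T m : Type*} [Fintype m] {S S' : Type*} [CommRing S] [Algebra ℂ S]
  [CommRing S'] [Algebra ℂ S']

/-- The point `A x`. -/
def applyMat (A : Fin n × Fin n → S) (x : Fin n → S) (k : Fin n) : S := ∑ l, A (k, l) * x l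

/-- The entry `(a, c)` of the last `n - i` columns of the Jacobian matrix of `x ↦ f (A x)`. -/
def polarJac (f : Fin p → MvPolynomial (Fin n) ℂ) (i : ℕ) (A : Fin n × Fin n → S)
    (x : Fin n → S) (a : Fin p) (c : Fin (n - i)) : S :=
  ∑ k, aeval (applyMat A x) (pderiv k (f a)) * A (k, colIdx n i c)

/-- The affine parametrization `κ₀ + v κ` of multiplier vectors. -/
def multiplier (κ₀ : T → Fin p → ℂ) (κ : m → Fin p → ℂ) (v : T × m → S) (t : T) (a : Fin p) : S :=
  algebraMap ℂ S (κ₀ t a) + ∑ b, v (t, b) * algebraMap ℂ S (κ b a)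

/-- The system `f (A x) = 0`, `u_t · jac = 0` with multipliers `u_t = κ₀ t + v_t κ`. -/
def polarSystem (f : Fin p → MvPolynomial (Fin n) ℂ) (i : ℕ) (κ₀ : T → Fin p → ℂ)
    (κ : m → Fin p → ℂ) (ξ : (Fin n × Fin n) ⊕ (Fin n ⊕ (T × m)) → S) :
    Fin p ⊕ (T × Fin (n - i)) → S :=
  Sum.elim (fun a => aeval (applyMat (ξ ∘ Sum.inl) (ξ ∘ Sum.inr ∘ Sum.inl)) (f a))
    (fun tc => ∑ a, multiplier κ₀ κ (ξ ∘ Sum.inr ∘ Sum.inr) tc.1 a *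
      polarJac f i (ξ ∘ Sum.inl) (ξ ∘ Sum.inr ∘ Sum.inl) a tc.2)

lemma map_applyMat (φ : S →ₐ[ℂ] S') (A : Fin n × Fin n → S) (x : Fin n → S) (k : Fin n) :
    φ (applyMat A x k) = applyMat (φ ∘ A) (φ ∘ x) k := by
  simp [applyMat]

lemma map_aeval_applyMat (φ : S →ₐ[ℂ] S') (A : Fin n × Fin n → S) (x : Fin n → S)
    (P : MvPolynomial (Fin n) ℂ) :
    φ (aeval (applyMat A x) P) = aeval (applyMat (φ ∘ A) (φ ∘ x)) P := by
  rw [← AlgHom.comp_apply, comp_aeval]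
  congr 2
  funext k
  exact map_applyMat φ A x k

lemma map_polarJac (φ : S →ₐ[ℂ] S') (f : Fin p → MvPolynomial (Fin n) ℂ) (i : ℕ)
    (A : Fin n × Fin n → S) (x : Fin n → S) (a : Fin p) (c : Fin (n - i)) :
    φ (polarJac f i A x a c) = polarJac f i (φ ∘ A) (φ ∘ x) a c := by
  simp [polarJac, map_aeval_applyMat]

lemma map_multiplier (φ : S →ₐ[ℂ] S') (κ₀ : T → Fin p → ℂ) (κ : m → Fin p → ℂ) (v : T × m → S)
    (t : T) (a : Fin p) : φ (multiplier κ₀ κ v t a) = multiplier κ₀ κ (φ ∘ v) t a := by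
  simp [multiplier]

lemma map_polarSystem (φ : S →ₐ[ℂ] S') (f : Fin p → MvPolynomial (Fin n) ℂ) (i : ℕ)
    (κ₀ : T → Fin p → ℂ) (κ : m → Fin p → ℂ) (ξ : (Fin n × Fin n) ⊕ (Fin n ⊕ (T × m)) → S)
    (j : Fin p ⊕ (T × Fin (n - i))) :
    φ (polarSystem f i κ₀ κ ξ j) = polarSystem f i κ₀ κ (φ ∘ ξ) j := by
  rcases j with a | tc
  · exact map_aeval_applyMat φ _ _ _
  · simp only [polarSystem, Sum.elim_inr, map_sum, map_mul, map_multiplier, map_polarJac]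
    rfl

/-- The system as polynomials in the entries of `A`, the coordinates of `x` and the `v`. -/
def polarSystemPoly (f : Fin p → MvPolynomial (Fin n) ℂ) (i : ℕ) (κ₀ : T → Fin p → ℂ)
    (κ : m → Fin p → ℂ) :
    Fin p ⊕ (T × Fin (n - i)) → MvPolynomial ((Fin n × Fin n) ⊕ (Fin n ⊕ (T × m))) ℂ :=
  polarSystem f i κ₀ κ X

lemma aeval_polarSystemPoly (f : Fin p → MvPolynomial (Fin n) ℂ) (i : ℕ)
    (κ₀ : T → Fin p → ℂ) (κ : m → Fin p → ℂ) (ξ : (Fin n × Fin n) ⊕ (Fin n ⊕ (T × m)) → S)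
    (j : Fin p ⊕ (T × Fin (n - i))) :
    aeval ξ (polarSystemPoly f i κ₀ κ j) = polarSystem f i κ₀ κ ξ j := by
  rw [polarSystemPoly, map_polarSystem]
  congr 1
  funext s
  simp

end System

section Degree

lemma totalDegree_aeval_le {k σ τ : Type*} [Field k] (y : σ → MvPolynomial τ k) (N : ℕ)
    (hy : ∀ s, (y s).totalDegree ≤ N) (P : MvPolynomial σ k) :
    (aeval y P).totalDegree ≤ N * P.totalDegree := by
  rw [aeval_def, eval₂_eq]
  refine totalDegree_finsetSum_le fun d hd => ?_
  refine (totalDegree_mul _ _).trans ?_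
  rw [algebraMap_eq, totalDegree_C, zero_add]
  refine (totalDegree_finsetProd _ _).trans ?_
  refine (Finset.sum_le_sum fun i _ => (totalDegree_pow _ _).trans
    (Nat.mul_le_mul_left _ (hy i))).trans ?_
  rw [← Finset.sum_mul, mul_comm]
  exact Nat.mul_le_mul_left _ (le_totalDegree hd)

lemma totalDegree_pderiv_le {k σ : Type*} [Field k] (s : σ) (P : MvPolynomial σ k) :
    (pderiv s P).totalDegree ≤ P.totalDegree - 1 := by
  classical
  conv_lhs => rw [P.as_sum, map_sum]
  refine totalDegree_finsetSum_le fun d hd => ?_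
  rw [pderiv_monomial]
  by_cases hs : d s = 0
  · simp [hs]
  · refine (totalDegree_monomial_le _ _).trans ?_
    have h1 : (d - Finsupp.single s 1).degree + 1 = d.degree := by
      have h2 : d - Finsupp.single s 1 + Finsupp.single s 1 = d :=
        tsub_add_cancel_of_le (by rw [Finsupp.single_le_iff]; omega)
      conv_rhs => rw [← h2]
      rw [map_add, Finsupp.degree_single]
    have h3 : d.degree ≤ P.totalDegree := le_totalDegree hd
    change (d - Finsupp.single s 1).degree ≤ _
    omega

variable {n p : ℕ} {T m : Type*} [Fintype m]

lemma totalDegree_polarSystemPoly_le {f : Fin p → MvPolynomial (Fin n) ℂ} {d : ℕ} (hd : 0 < d)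
    (hf : ∀ a, (f a).totalDegree ≤ d) (i : ℕ) (κ₀ : T → Fin p → ℂ) (κ : m → Fin p → ℂ)
    (j : Fin p ⊕ (T × Fin (n - i))) :
    (polarSystemPoly f i κ₀ κ j).totalDegree ≤ 2 * d := by
  have hy : ∀ k : Fin n, (applyMat (S := MvPolynomial ((Fin n × Fin n) ⊕ (Fin n ⊕ (T × m))) ℂ)
      (X ∘ Sum.inl) (X ∘ Sum.inr ∘ Sum.inl) k).totalDegree ≤ 2 := fun k => by
    refine totalDegree_finsetSum_le fun l _ => (totalDegree_mul _ _).trans ?_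
    simp
  rcases j with a | ⟨t, c⟩
  · exact (totalDegree_aeval_le _ 2 hy _).trans (Nat.mul_le_mul_left 2 (hf a))
  · simp only [polarSystemPoly, polarSystem, Sum.elim_inr]
    refine totalDegree_finsetSum_le fun a _ => (totalDegree_mul _ _).trans ?_
    have h1 : (multiplier κ₀ κ (S := MvPolynomial ((Fin n × Fin n) ⊕ (Fin n ⊕ (T × m))) ℂ)
        (X ∘ Sum.inr ∘ Sum.inr) t a).totalDegree ≤ 1 := by
      refine (totalDegree_add _ _).trans (max_le (by simp [algebraMap_eq]) ?_)
      refine totalDegree_finsetSum_le fun b _ => (totalDegree_mul _ _).trans ?_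
      simp [algebraMap_eq]
    have h2 : (polarJac f i (S := MvPolynomial ((Fin n × Fin n) ⊕ (Fin n ⊕ (T × m))) ℂ)
        (X ∘ Sum.inl) (X ∘ Sum.inr ∘ Sum.inl) a c).totalDegree ≤ 2 * (d - 1) + 1 := by
      refine totalDegree_finsetSum_le fun k _ => (totalDegree_mul _ _).trans ?_
      refine Nat.add_le_add ((totalDegree_aeval_le _ 2 hy _).trans (Nat.mul_le_mul_left 2
        ((totalDegree_pderiv_le _ _).trans (Nat.sub_le_sub_right (hf a) 1)))) (by simp)
    refine (Nat.add_le_add h1 h2).trans ?_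
    omega

end Degree

section Smooth

lemma coeff_zero_aeval {σ L : Type*} [Field L] [Algebra ℂ L] (Y : σ → Polynomial L)
    (Q : MvPolynomial σ ℂ) :
    (aeval Y Q).coeff 0 = aeval (fun s => (Y s).coeff 0) Q := by
  have : ((Polynomial.constantCoeff : Polynomial L →+* L).comp
      (aeval Y : MvPolynomial σ ℂ →ₐ[ℂ] Polynomial L).toRingHom) =
      (aeval (fun s => (Y s).coeff 0) : MvPolynomial σ ℂ →ₐ[ℂ] L).toRingHom := by
    refine MvPolynomial.ringHom_ext (fun r => ?_) (fun s => ?_)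
    · simp [Polynomial.constantCoeff, Polynomial.algebraMap_apply]
    · simp [Polynomial.constantCoeff]
  exact RingHom.congr_fun this Q

lemma coeff_one_aeval {σ L : Type*} [Fintype σ] [Field L] [Algebra ℂ L] (Y : σ → Polynomial L)
    (P : MvPolynomial σ ℂ) :
    (aeval Y P).coeff 1 =
      ∑ k, aeval (fun s => (Y s).coeff 0) (pderiv k P) * (Y k).coeff 1 := by
  classical
  induction P using MvPolynomial.induction_on with
  | C a => simp [Polynomial.algebraMap_apply]
  | add P Q hP hQ => simp [hP, hQ, add_mul, Finset.sum_add_distrib]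
  | mul_X P s hP =>
    rw [map_mul, Polynomial.mul_coeff_one, coeff_zero_aeval, hP, aeval_X]
    simp only [Derivation.leibniz, pderiv_X, smul_eq_mul, map_add, map_mul, aeval_X, add_mul,
      Finset.sum_add_distrib, Finset.sum_mul]
    congr 1
    · rw [Finset.sum_eq_single s]
      · simp
      · intro k _ hk; simp [hk]
      · simp
    · exact Finset.sum_congr rfl fun k _ => by ring

variable {n p : ℕ} {T m : Type*} [Fintype m] {L : Type*} [Field L] [Algebra ℂ L]

/-- A zero of the system is smooth if the Jacobian matrix of `f`, the multipliers and `A` have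
full rank. -/
theorem isSmoothZero_polarSystemPoly (f : Fin p → MvPolynomial (Fin n) ℂ) (i : ℕ)
    (κ₀ : T → Fin p → ℂ) (κ : m → Fin p → ℂ) (ξ : (Fin n × Fin n) ⊕ (Fin n ⊕ (T × m)) → L)
    (hzero : ∀ j, polarSystem f i κ₀ κ ξ j = 0)
    (hH : ∀ w : Fin p → L, ∃ δ : Fin n → L, ∀ a, ∑ k,
      aeval (applyMat (ξ ∘ Sum.inl) (ξ ∘ Sum.inr ∘ Sum.inl)) (pderiv k (f a)) * δ k = w a)
    (hU : ∀ w : T → L, ∃ δ : Fin p → L, ∀ t,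
      ∑ a, multiplier κ₀ κ (ξ ∘ Sum.inr ∘ Sum.inr) t a * δ a = w t)
    (hA : ∀ w : Fin n → L, ∃ δ : Fin n → L, ∀ k, ∑ l, ξ (Sum.inl (k, l)) * δ l = w k) :
    IsSmoothZero (polarSystemPoly f i κ₀ κ) ξ := by
  refine ⟨fun j => by rw [aeval_polarSystemPoly, hzero], fun w => ?_⟩
  set A := ξ ∘ Sum.inl with hAdef
  set x := ξ ∘ Sum.inr ∘ Sum.inl with hxdef
  set y := applyMat A x with hy
  obtain ⟨δy, hδy⟩ := hH (w ∘ Sum.inl)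
  set known : T × Fin (n - i) → L := fun tc => ∑ a,
    multiplier κ₀ κ (ξ ∘ Sum.inr ∘ Sum.inr) tc.1 a * ∑ k,
      (∑ l, aeval y (pderiv l (pderiv k (f a))) * δy l) * A (k, colIdx n i tc.2) with hknown
  have hcol : ∀ c : Fin (n - i), ∃ δ : Fin n → L, ∀ t,
      ∑ a, multiplier κ₀ κ (ξ ∘ Sum.inr ∘ Sum.inr) t a *
        ∑ k, aeval y (pderiv k (f a)) * δ k = w (Sum.inr (t, c)) - known (t, c) := by
    intro c
    obtain ⟨δ₁, h₁⟩ := hU fun t => w (Sum.inr (t, c)) - known (t, c)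
    obtain ⟨δ₂, h₂⟩ := hH δ₁
    exact ⟨δ₂, fun t => by simp only [h₂, h₁]⟩
  choose δc hδc using hcol
  set δA : Fin n × Fin n → L := fun kl =>
    if h : i ≤ kl.2 then δc ⟨kl.2 - i, by omega⟩ kl.1 else 0 with hδA
  have hδA' : ∀ k c, δA (k, colIdx n i c) = δc c k := by
    intro k c
    simp [hδA, colIdx]
  obtain ⟨δx, hδx⟩ := hA fun k => δy k - ∑ l, δA (k, l) * x l
  refine ⟨Sum.elim δA (Sum.elim δx 0), ?_⟩
  set Ξ : (Fin n × Fin n) ⊕ (Fin n ⊕ (T × m)) → Polynomial L := fun s =>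
    Polynomial.C (ξ s) + Polynomial.C (Sum.elim δA (Sum.elim δx 0) s) * Polynomial.X with hΞ
  have hY0 : ∀ k, (applyMat (Ξ ∘ Sum.inl) (Ξ ∘ Sum.inr ∘ Sum.inl) k).coeff 0 = y k := by
    intro k
    simp [applyMat, hy, hΞ, hAdef, hxdef]
  have hY1 : ∀ k, (applyMat (Ξ ∘ Sum.inl) (Ξ ∘ Sum.inr ∘ Sum.inl) k).coeff 1 = δy k := by
    intro k
    have h1 := hδx k
    simp only [applyMat, Polynomial.finsetSum_coeff, Polynomial.mul_coeff_one, hΞ,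
      Function.comp_apply, Finset.sum_add_distrib]
    simp only [Polynomial.coeff_add, Polynomial.coeff_C_zero, Polynomial.coeff_C_mul,
      Polynomial.coeff_X_zero, Polynomial.coeff_X_one, mul_zero, add_zero, mul_one, zero_add,
      Sum.elim_inl, Sum.elim_inr, Polynomial.coeff_C_of_ne_zero one_ne_zero]
    rw [h1]
    simp [hxdef]
  intro j
  rw [aeval_polarSystemPoly]
  rcases j with a | ⟨t, c⟩
  · simp only [polarSystem, Sum.elim_inl]
    rw [coeff_one_aeval]
    simp only [hY0, hY1]
    exact hδy a
  · have hu : ∀ a, multiplier κ₀ κ (Ξ ∘ Sum.inr ∘ Sum.inr) t a =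
        Polynomial.C (multiplier κ₀ κ (ξ ∘ Sum.inr ∘ Sum.inr) t a) := by
      intro a
      simp [multiplier, hΞ, Polynomial.algebraMap_apply]
    have hj0 : ∀ P : MvPolynomial (Fin n) ℂ,
        (aeval (applyMat (Ξ ∘ Sum.inl) (Ξ ∘ Sum.inr ∘ Sum.inl)) P).coeff 0 = aeval y P := by
      intro P
      rw [coeff_zero_aeval]
      simp only [hY0]
    have hj : ∀ a, (polarJac f i (Ξ ∘ Sum.inl) (Ξ ∘ Sum.inr ∘ Sum.inl) a c).coeff 1 =
        ∑ k, aeval y (pderiv k (f a)) * δc c k +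
        ∑ k, (∑ l, aeval y (pderiv l (pderiv k (f a))) * δy l) * A (k, colIdx n i c) := by
      intro a
      simp only [polarJac, Polynomial.finsetSum_coeff, Polynomial.mul_coeff_one, hj0,
        coeff_one_aeval, hY0, hY1, Finset.sum_add_distrib]
      congr 1
      · refine Finset.sum_congr rfl fun k _ => ?_
        rw [← hδA']
        simp [hΞ, Polynomial.coeff_C_of_ne_zero one_ne_zero]
      · refine Finset.sum_congr rfl fun k _ => ?_
        simp [hΞ, hAdef]
    simp only [polarSystem, Sum.elim_inr, hu, Polynomial.finsetSum_coeff, Polynomial.coeff_C_mul,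
      hj, mul_add, Finset.sum_add_distrib]
    rw [hδc c t, hknown]
    ring

end Smooth

section LinearAlgebra

variable {ι κ L : Type*} [Field L]

lemma linearIndependent_rows_of_forall [Fintype ι] {M : ι → κ → L}
    (h : ∀ u : ι → L, (∀ k, ∑ a, u a * M a k = 0) → u = 0) : LinearIndependent L M := by
  rw [Fintype.linearIndependent_iff]
  intro u hu a
  rw [h u fun k => by simpa using congrFun hu k]
  rfl

lemma exists_sum_mul_eq_of_rows [Fintype ι] [Fintype κ] {M : ι → κ → L}
    (h : ∀ u : ι → L, (∀ k, ∑ a, u a * M a k = 0) → u = 0) (w : ι → L) :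
    ∃ δ : κ → L, ∀ a, ∑ k, M a k * δ k = w a := by
  classical
  have hrank : (Matrix.of M).rank = Fintype.card ι :=
    LinearIndependent.rank_matrix (M := Matrix.of M) (linearIndependent_rows_of_forall h)
  have htop : LinearMap.range (Matrix.of M).mulVecLin = ⊤ :=
    Submodule.eq_top_of_finrank_eq (by
      rw [← Matrix.rank, hrank, Module.finrank_fintype_fun_eq_card])
  obtain ⟨δ, hδ⟩ := LinearMap.range_eq_top.1 htop w
  exact ⟨δ, fun a => congrFun hδ a⟩

lemma exists_det_ne_zero_of_rows [Fintype κ] {p : ℕ} {M : Fin p → κ → L}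
    (h : ∀ u : Fin p → L, (∀ k, ∑ a, u a * M a k = 0) → u = 0) :
    ∃ c : Fin p ↪ κ, (Matrix.of fun a b : Fin p => M a (c b)).det ≠ 0 := by
  classical
  obtain ⟨J, s, hs, hspan, hli⟩ := exists_linearIndependent' L (fun (k : κ) (a : Fin p) => M a k)
  have htop : Submodule.span L (Set.range fun (k : κ) (a : Fin p) => M a k) = ⊤ := by
    rw [eq_top_iff]
    intro w _
    obtain ⟨δ, hδ⟩ := exists_sum_mul_eq_of_rows h w
    have : w = ∑ k, δ k • (fun a => M a k) := by
      funext a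
      rw [← hδ a]
      simp [mul_comm]
    rw [this]
    exact Submodule.sum_mem _ fun k _ => Submodule.smul_mem _ _ (Submodule.subset_span ⟨k, rfl⟩)
  let bas := Module.Basis.mk hli (by rw [hspan, htop])
  let e : Fin p ≃ J := (Pi.basisFun L (Fin p)).indexEquiv bas
  refine ⟨⟨s ∘ e, hs.comp e.injective⟩, fun hdet => ?_⟩
  obtain ⟨v, hv, hv0⟩ := Matrix.exists_mulVec_eq_zero_iff.2 hdet
  have hli' : LinearIndependent L ((fun (k : κ) (a : Fin p) => M a k) ∘ s ∘ e) :=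
    hli.comp e e.injective
  rw [Fintype.linearIndependent_iff] at hli'
  refine hv (funext fun b => hli' v (funext fun a => ?_) b)
  have := congrFun hv0 a
  simpa [Matrix.mulVec, dotProduct, mul_comm] using this

/-- A maximal independent set of rows. -/
lemma exists_row_basis [Fintype ι] (M : ι → κ → L) :
    ∃ I : Finset ι, LinearIndependent L (fun a : I => M a) ∧
      ∀ a, ∃ U : I → L, ∀ k, M a k = ∑ b : I, U b * M b k := by
  classical
  obtain ⟨J, s, hs, hspan, hli⟩ := exists_linearIndependent' L M
  have : Finite J := Finite.of_injective s hs
  have := Fintype.ofFinite J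
  have hI : ∀ b : (Finset.univ.image s : Finset ι), ∃ j, s j = b := fun b => by
    obtain ⟨j, -, hj⟩ := Finset.mem_image.1 b.2
    exact ⟨j, hj⟩
  choose r hr using hI
  have hli' : LinearIndependent L (fun a : (Finset.univ.image s : Finset ι) => M a) := by
    have := hli.comp r fun b b' hbb => Subtype.ext (by rw [← hr, hbb, hr])
    have e : (fun a : (Finset.univ.image s : Finset ι) => M a) = (M ∘ s) ∘ r :=
      funext fun a => by simp [hr]
    rwa [e]
  refine ⟨Finset.univ.image s, hli', fun a => ?_⟩
  have ha : M a ∈ Submodule.span L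
      (Set.range fun b : (Finset.univ.image s : Finset ι) => M b) := by
    have h1 : M a ∈ Submodule.span L (Set.range M) := Submodule.subset_span ⟨a, rfl⟩
    rw [← hspan] at h1
    refine Submodule.span_mono ?_ h1
    rintro _ ⟨j, rfl⟩
    exact ⟨⟨s j, by simp⟩, rfl⟩
  obtain ⟨U, hU⟩ := (Submodule.mem_span_range_iff_exists_fun L).1 ha
  exact ⟨U, fun k => by rw [← hU]; simp⟩

end LinearAlgebra

section Points

variable {n p : ℕ}

/-- If the Jacobian matrix has full rank at all complex zeros of `f`, then it has full rank at
zeros with coordinates in any extension field. -/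
theorem jacobian_rows_independent {f : Fin p → MvPolynomial (Fin n) ℂ}
    (hsm : ∀ x : Fin n → ℂ, (∀ j, eval x (f j) = 0) → (jacEval f x).rank = p)
    {L : Type*} [Field L] [Algebra ℂ L] {y : Fin n → L} (hy : ∀ a, aeval y (f a) = 0)
    (u : Fin p → L) (hu : ∀ k, ∑ a, u a * aeval y (pderiv k (f a)) = 0) : u = 0 := by
  by_contra hne
  obtain ⟨a₀, ha₀⟩ := Function.ne_iff.1 hne
  simp only [Pi.zero_apply] at ha₀
  let φ : MvPolynomial (Fin n ⊕ Fin p) ℂ →ₐ[ℂ] L :=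
    aeval (Sum.elim y fun a => (u a₀)⁻¹ * u a)
  obtain ⟨M, hM, hle⟩ := Ideal.exists_le_maximal (RingHom.ker φ) (RingHom.ker_ne_top _)
  obtain ⟨x, hx⟩ := eq_vanishingIdeal_singleton_of_isMaximal ℂ hM
  have hpt : ∀ P, φ P = 0 → aeval x P = 0 := fun P hP =>
    (mem_vanishingIdeal_singleton_iff x P).1 (hx ▸ hle hP)
  have hren : ∀ P : MvPolynomial (Fin n) ℂ, φ (rename Sum.inl P) = aeval y P := fun P => by
    rw [aeval_rename]; rfl
  have hren' : ∀ P : MvPolynomial (Fin n) ℂ,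
      aeval x (rename Sum.inl P) = eval (x ∘ Sum.inl) P := fun P => by
    rw [aeval_rename]; rfl
  have h1 : ∀ a, eval (x ∘ Sum.inl) (f a) = 0 := fun a => by
    rw [← hren']
    exact hpt _ (by rw [hren, hy])
  have h2 : ∀ k, ∑ a, x (Sum.inr a) * eval (x ∘ Sum.inl) (pderiv k (f a)) = 0 := fun k => by
    have := hpt (∑ a, X (Sum.inr a) * rename Sum.inl (pderiv k (f a))) (by
      simp only [map_sum, map_mul, hren]
      simp only [φ, aeval_X, Sum.elim_inr, mul_assoc, ← Finset.mul_sum, hu, mul_zero])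
    simpa only [map_sum, map_mul, hren', aeval_X] using this
  have h3 : x (Sum.inr a₀) = 1 := by
    have := hpt (X (Sum.inr a₀) - 1) (by simp [φ, ha₀])
    simpa [sub_eq_zero] using this
  have hrank := hsm _ h1
  rw [Matrix.rank_eq_finrank_span_row] at hrank
  have hli : LinearIndependent ℂ (jacEval f (x ∘ Sum.inl)).row := by
    rw [linearIndependent_iff_card_eq_finrank_span, Fintype.card_fin]
    exact hrank.symm
  rw [Fintype.linearIndependent_iff] at hli
  have := hli (fun a => x (Sum.inr a)) (funext fun k => by
    simpa [jacEval, Matrix.row] using h2 k) a₀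
  rw [h3] at this
  exact one_ne_zero this

lemma pderiv_aeval_chain {σ τ K : Type*} [Fintype σ] [Field K] [Algebra ℂ K]
    (Y : σ → MvPolynomial τ K) (j : τ) (P : MvPolynomial σ ℂ) :
    pderiv j (aeval Y P) = ∑ k, aeval Y (pderiv k P) * pderiv j (Y k) := by
  classical
  induction P using MvPolynomial.induction_on with
  | C a =>
    simp [MvPolynomial.algebraMap_apply]
  | add P Q hP hQ => simp [hP, hQ, add_mul, Finset.sum_add_distrib]
  | mul_X P s hP =>
    simp only [map_mul, aeval_X, Derivation.leibniz, hP, pderiv_X, smul_eq_mul, map_add, add_mul,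
      Finset.sum_add_distrib, Finset.mul_sum]
    congr 1
    · rw [Finset.sum_eq_single s]
      · simp
      · intro k _ hk; simp [hk]
      · simp
    · exact Finset.sum_congr rfl fun k _ => by ring

lemma genChange_eq (f : MvPolynomial (Fin n) ℤ) :
    genChange f = aeval (applyMat (fun kl : Fin n × Fin n => C (genEntry n kl.1 kl.2)) X)
      (toC f) := by
  simp only [genChange, toC, aeval_def, eval₂_map]
  congr 1
  exact RingHom.ext_int _ _

lemma pderiv_genChange (F : Fin p → MvPolynomial (Fin n) ℤ) (i : ℕ) (a : Fin p)
    (c : Fin (n - i)) :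
    pderiv (colIdx n i c) (genChange (F a)) =
      polarJac (fun a => toC (F a)) i (fun kl : Fin n × Fin n => C (genEntry n kl.1 kl.2)) X a c :=
        by
  classical
  rw [genChange_eq, pderiv_aeval_chain, polarJac]
  refine Finset.sum_congr rfl fun k _ => ?_
  congr 1
  simp [applyMat, pderiv_X, Pi.single_apply]

variable {L : Type*} [Field L] [Algebra ℂ L] [Algebra (GenField n) L]
  [IsScalarTower ℂ (GenField n) L]

/-- The generic matrix in an extension field of `K`. -/
def genMat (n : ℕ) (L : Type*) [Field L] [Algebra (GenField n) L] (kl : Fin n × Fin n) : L :=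
  algebraMap (GenField n) L (genEntry n kl.1 kl.2)

lemma aeval_genChange (F : MvPolynomial (Fin n) ℤ) (x : Fin n → L) :
    aeval x (genChange F) = aeval (applyMat (genMat n L) x) (toC F) := by
  have := map_aeval_applyMat ((aeval x : MvPolynomial (Fin n) (GenField n) →ₐ[_] L).restrictScalars
    ℂ) (fun kl : Fin n × Fin n => C (genEntry n kl.1 kl.2)) X (toC F)
  rw [← genChange_eq] at this
  refine this.trans ?_
  congr 3
  · funext kl; simp [genMat]
  · funext k; simp

lemma aeval_pderiv_genChange (F : Fin p → MvPolynomial (Fin n) ℤ) (i : ℕ) (a : Fin p)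
    (c : Fin (n - i)) (x : Fin n → L) :
    aeval x (pderiv (colIdx n i c) (genChange (F a))) =
      polarJac (fun a => toC (F a)) i (genMat n L) x a c := by
  have := map_polarJac ((aeval x : MvPolynomial (Fin n) (GenField n) →ₐ[_] L).restrictScalars
    ℂ) (fun a => toC (F a)) i (fun kl : Fin n × Fin n => C (genEntry n kl.1 kl.2)) X a c
  rw [← pderiv_genChange] at this
  refine this.trans ?_
  congr 1
  · funext kl; simp [genMat]
  · funext k; simp

/-- The zeros of the polar ideal are the zeros of `f (A x)` at which the truncated Jacobian has
dependent rows. -/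
theorem polarIdealK_le_ker_iff (F : Fin p → MvPolynomial (Fin n) ℤ) (i : ℕ) (x : Fin n → L) :
    (∀ P ∈ polarIdealK (fun a => genChange (F a)) i, aeval x P = 0) ↔
      (∀ a, aeval (applyMat (genMat n L) x) (toC (F a)) = 0) ∧
      ∃ w : Fin p → L, w ≠ 0 ∧
        ∀ c, ∑ a, w a * polarJac (fun a => toC (F a)) i (genMat n L) x a c = 0 := by
  classical
  have hminor : ∀ c : Fin p ↪ Fin (n - i), aeval x (Matrix.det (Matrix.of fun a b : Fin p =>
      pderiv (colIdx n i (c b)) (genChange (F a)))) =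
      (Matrix.of fun a b : Fin p =>
        polarJac (fun a => toC (F a)) i (genMat n L) x a (c b)).det := by
    intro c
    rw [AlgHom.map_det]
    congr 1
    ext a b
    simp [aeval_pderiv_genChange]
  constructor
  · intro h
    refine ⟨fun a => ?_, ?_⟩
    · rw [← aeval_genChange]
      exact h _ (Ideal.subset_span (Or.inl ⟨a, rfl⟩))
    · by_contra! hcon
      obtain ⟨c, hc⟩ := exists_det_ne_zero_of_rows
        (M := polarJac (fun a => toC (F a)) i (genMat n L) x) (fun u hu => by
          by_contra hne
          obtain ⟨c, hc⟩ := hcon u hne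
          exact hc (hu c))
      exact hc ((hminor c).symm.trans (h _ (Ideal.subset_span (Or.inr ⟨c, rfl⟩))))
  · rintro ⟨h1, w, hw, h2⟩ P hP
    have hle : polarIdealK (fun a => genChange (F a)) i ≤
        RingHom.ker (aeval x : MvPolynomial (Fin n) (GenField n) →ₐ[_] L) := by
      refine Ideal.span_le.2 ?_
      rintro _ (⟨a, rfl⟩ | ⟨c, rfl⟩)
      · exact (aeval_genChange _ _).trans (h1 a)
      · refine (hminor c).trans (Matrix.exists_vecMul_eq_zero_iff.1 ⟨w, hw, ?_⟩)
        funext b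
        simpa [Matrix.vecMul, dotProduct] using h2 (c b)
    exact hle hP

lemma genMat_rows (n : ℕ) (L : Type*) [Field L] [Algebra (GenField n) L] (u : Fin n → L)
    (hu : ∀ l, ∑ k, u k * genMat n L (k, l) = 0) : u = 0 := by
  by_contra hne
  have h1 : (Matrix.of fun k l => genMat n L (k, l)).det = 0 :=
    Matrix.exists_vecMul_eq_zero_iff.1 ⟨u, hne, funext fun l => by
      simpa [Matrix.vecMul, dotProduct] using hu l⟩
  have h2 : (Matrix.of fun k l => genMat n L (k, l)) =
      ((algebraMap (GenField n) L).comp (algebraMap (MvPolynomial (Fin n × Fin n) ℂ)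
        (GenField n))).mapMatrix (Matrix.mvPolynomialX (Fin n) (Fin n) ℂ) := by
    ext k l
    simp [genMat, genEntry, Matrix.mvPolynomialX]
  rw [h2, ← RingHom.map_det] at h1
  have hinj : Function.Injective ((algebraMap (GenField n) L).comp
      (algebraMap (MvPolynomial (Fin n × Fin n) ℂ) (GenField n))) :=
    (algebraMap (GenField n) L).injective.comp (IsFractionRing.injective _ _)
  exact Matrix.det_mvPolynomialX_ne_zero (Fin n) ℂ ((injective_iff_map_eq_zero _).1 hinj _ h1)

end Points

section SmoothPoints

variable {n p : ℕ} {F : Fin p → MvPolynomial (Fin n) ℤ}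
  {L : Type*} [Field L] [Algebra ℂ L] [Algebra (GenField n) L]

lemma isSmoothZero_of_multipliers
    (hsm : ∀ x : Fin n → ℂ, (∀ j, eval x (toC (F j)) = 0) →
      (jacEval (fun j => toC (F j)) x).rank = p)
    {T m : Type*} [Fintype T] [Fintype m] (i : ℕ) (κ₀ : T → Fin p → ℂ) (κ : m → Fin p → ℂ)
    {x : Fin n → L} {v : T × m → L}
    (hx : ∀ a, aeval (applyMat (genMat n L) x) (toC (F a)) = 0)
    (hv : ∀ t c, ∑ a, multiplier κ₀ κ v t a *
      polarJac (fun a => toC (F a)) i (genMat n L) x a c = 0)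
    (hU : ∀ s : T → L, (∀ a, ∑ t, s t * multiplier κ₀ κ v t a = 0) → s = 0) :
    IsSmoothZero (polarSystemPoly (fun a => toC (F a)) i κ₀ κ)
      (Sum.elim (genMat n L) (Sum.elim x v)) := by
  have e1 : Sum.elim (genMat n L) (Sum.elim x v) ∘ Sum.inl = genMat n L := rfl
  have e2 : Sum.elim (genMat n L) (Sum.elim x v) ∘ Sum.inr ∘ Sum.inl = x := rfl
  have e3 : Sum.elim (genMat n L) (Sum.elim x v) ∘ Sum.inr ∘ Sum.inr = v := rfl
  refine isSmoothZero_polarSystemPoly _ i κ₀ κ _ ?_ ?_ ?_ ?_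
  · rintro (a | ⟨t, c⟩)
    · exact hx a
    · exact hv t c
  · rw [e1, e2]
    exact exists_sum_mul_eq_of_rows (jacobian_rows_independent hsm hx)
  · rw [e3]
    exact exists_sum_mul_eq_of_rows hU
  · exact exists_sum_mul_eq_of_rows (M := fun k l => genMat n L (k, l)) (genMat_rows n L)

/-- The base point of the multipliers `u` normalized by `∑ lam a * u a = 1`. -/
def normBase (a₀ : Fin p) (_ : Unit) : Fin p → ℂ := Pi.single a₀ 1

/-- The directions of the multipliers `u` normalized by `∑ lam a * u a = 1`. -/
def normDir (lam : Fin p → ℂ) (a₀ : Fin p) (b : {b : Fin p // b ≠ a₀}) : Fin p → ℂ :=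
  Pi.single b.1 1 - Pi.single a₀ (lam b)

lemma multiplier_norm (lam : Fin p → ℂ) (a₀ : Fin p) (hlam : lam a₀ = 1) (w : Fin p → L)
    (hw : ∑ a, algebraMap ℂ L (lam a) * w a = 1) (a : Fin p) :
    multiplier (normBase a₀) (normDir lam a₀) (fun tb => w tb.2) () a = w a := by
  classical
  simp only [multiplier, normBase, normDir, Pi.sub_apply, map_sub, mul_sub,
    Finset.sum_sub_distrib]
  rw [← Finset.sum_subtype (p := fun b => b ≠ a₀) (Finset.univ.erase a₀) (by simp)
      (fun b => w b * algebraMap ℂ L ((Pi.single b 1 : Fin p → ℂ) a)),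
    ← Finset.sum_subtype (p := fun b => b ≠ a₀) (Finset.univ.erase a₀) (by simp)
      (fun b => w b * algebraMap ℂ L ((Pi.single a₀ (lam b) : Fin p → ℂ) a))]
  by_cases ha : a = a₀
  · subst ha
    have h1 : ∑ b ∈ Finset.univ.erase a, w b * algebraMap ℂ L ((Pi.single b 1 : Fin p → ℂ) a) =
        0 := Finset.sum_eq_zero fun b hb => by
      rw [Pi.single_eq_of_ne (Finset.ne_of_mem_erase hb).symm, map_zero, mul_zero]
    rw [← Finset.add_sum_erase _ _ (Finset.mem_univ a), hlam] at hw
    rw [h1]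
    simp only [Pi.single_eq_same, map_one, one_mul, mul_comm (w _)] at hw ⊢
    linear_combination -hw
  · rw [Finset.sum_eq_single a]
    · simp [ha]
    · intro b _ hb
      rw [Pi.single_eq_of_ne hb.symm, map_zero, mul_zero]
    · simp [ha]

lemma isSmoothZero_norm
    (hsm : ∀ x : Fin n → ℂ, (∀ j, eval x (toC (F j)) = 0) →
      (jacEval (fun j => toC (F j)) x).rank = p)
    (i : ℕ) {lam : Fin p → ℂ} {a₀ : Fin p} (hlam : lam a₀ = 1) {x : Fin n → L} {w : Fin p → L}
    (hx : ∀ a, aeval (applyMat (genMat n L) x) (toC (F a)) = 0)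
    (hw : ∑ a, algebraMap ℂ L (lam a) * w a = 1)
    (hker : ∀ c, ∑ a, w a * polarJac (fun a => toC (F a)) i (genMat n L) x a c = 0) :
    IsSmoothZero (polarSystemPoly (fun a => toC (F a)) i (normBase a₀) (normDir lam a₀))
      (Sum.elim (genMat n L) (Sum.elim x fun tb : Unit × {b : Fin p // b ≠ a₀} => w tb.2)) := by
  refine isSmoothZero_of_multipliers hsm i _ _ hx (fun t c => ?_) (fun s hs => ?_)
  · simp only [multiplier_norm lam a₀ hlam w hw, hker]
  · funext t
    simp only [Finset.univ_unique, Finset.sum_singleton,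
      show (default : Unit) = () from rfl, multiplier_norm lam a₀ hlam w hw] at hs
    have : s () * ∑ a, algebraMap ℂ L (lam a) * w a = 0 := by
      rw [Finset.mul_sum]
      exact Finset.sum_eq_zero fun a _ => by rw [mul_left_comm, hs, mul_zero]
    rwa [hw, mul_one] at this

/-- On the polar variety, `X₁, …, X_i` and the generic matrix are algebraically dependent. -/
theorem exists_relation_of_polar [IsScalarTower ℂ (GenField n) L]
    (hsm : ∀ x : Fin n → ℂ, (∀ j, eval x (toC (F j)) = 0) →
      (jacEval (fun j => toC (F j)) x).rank = p)
    {i : ℕ} (hi1 : 1 ≤ i) (hi : i ≤ n) {x : Fin n → L}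
    (hx : ∀ P ∈ polarIdealK (fun a => genChange (F a)) i, aeval x P = 0) :
    ∃ b : MvPolynomial ((Fin n × Fin n) ⊕ Fin i) ℂ, b ≠ 0 ∧
      aeval (Sum.elim (genMat n L) (x ∘ Fin.castLE hi)) b = 0 := by
  classical
  obtain ⟨hx0, w, hw, hker⟩ := (polarIdealK_le_ker_iff F i x).1 hx
  obtain ⟨a₀, ha₀⟩ := Function.ne_iff.1 hw
  simp only [Pi.zero_apply] at ha₀
  have hinf : Infinite L := Infinite.of_injective _ (algebraMap ℂ L).injective
  have hsmooth := isSmoothZero_norm hsm i (lam := Pi.single a₀ 1) (a₀ := a₀) (by simp) (x := x)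
    (w := fun a => (w a₀)⁻¹ * w a) hx0
    (by
      rw [Finset.sum_eq_single a₀]
      · simp [ha₀]
      · intro b _ hb; simp [hb]
      · simp)
    (fun c => by simp only [mul_assoc, ← Finset.mul_sum, hker, mul_zero])
  have : Nonempty (Fin i) := ⟨⟨0, hi1⟩⟩
  obtain ⟨b, hb, hb0⟩ := exists_ne_zero_aeval_eq_zero (τ := (Fin n × Fin n) ⊕ Fin i) (by
    have hp : 0 < p := a₀.pos
    have : Fintype.card {b : Fin p // b ≠ a₀} = p - 1 := by simp
    simp only [Fintype.card_sum, Fintype.card_prod, Fintype.card_fin, Fintype.card_unit, this]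
    omega) hsmooth (Sum.map id (Sum.inl ∘ Fin.castLE hi))
  refine ⟨b, hb, ?_⟩
  rw [← hb0]
  congr 2
  funext s
  rcases s with s | s <;> rfl

end SmoothPoints

section LeadingCoefficient

variable {K R σ : Type*} [CommRing K] [CommRing R] [Algebra K R]

lemma coeff_aeval_monomial_of_natDegree_le_one {y : σ → Polynomial R}
    (hy : ∀ s, (y s).natDegree ≤ 1) (d : σ →₀ ℕ) :
    (aeval y (monomial d (1 : K))).natDegree ≤ d.degree ∧
      (aeval y (monomial d (1 : K))).coeff d.degree =
        aeval (fun s => (y s).coeff 1) (monomial d (1 : K)) := by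
  induction d using Finsupp.induction_linear with
  | zero => simp
  | add d e hd he =>
    have h : (monomial (d + e) (1 : K)) = monomial d 1 * monomial e 1 := by
      rw [monomial_mul, one_mul]
    rw [h, map_mul, map_mul, map_add, ← hd.2, ← he.2]
    exact ⟨Polynomial.natDegree_mul_le.trans (add_le_add hd.1 he.1),
      Polynomial.coeff_mul_add_eq_of_natDegree_le hd.1 he.1⟩
  | single s k =>
    rw [← X_pow_eq_monomial, map_pow, map_pow, aeval_X, aeval_X, Finsupp.degree_single]
    refine ⟨Polynomial.natDegree_pow_le.trans (by nlinarith [hy s]), ?_⟩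
    simpa using Polynomial.coeff_pow_of_natDegree_le (m := k) (hy s)

lemma natDegree_aeval_le_of_natDegree_le_one {y : σ → Polynomial R}
    (hy : ∀ s, (y s).natDegree ≤ 1) (P : MvPolynomial σ K) :
    (aeval y P).natDegree ≤ P.totalDegree := by
  rw [P.as_sum, map_sum]
  refine Polynomial.natDegree_sum_le_of_forall_le _ _ fun d hd => ?_
  have h : monomial d (P.coeff d) = P.coeff d • monomial d (1 : K) := by
    rw [smul_monomial, smul_eq_mul, mul_one]
  rw [h, map_smul, ← P.as_sum]
  exact (Polynomial.natDegree_smul_le _ _).trans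
    ((coeff_aeval_monomial_of_natDegree_le_one hy d).1.trans (le_totalDegree hd))

lemma coeff_totalDegree_aeval_of_natDegree_le_one {y : σ → Polynomial R}
    (hy : ∀ s, (y s).natDegree ≤ 1) (P : MvPolynomial σ K) :
    (aeval y P).coeff P.totalDegree =
      aeval (fun s => (y s).coeff 1) (homogeneousComponent P.totalDegree P) := by
  classical
  set N := P.totalDegree with hN
  rw [homogeneousComponent_apply, map_sum]
  conv_lhs => rw [P.as_sum]
  rw [map_sum, Polynomial.finsetSum_coeff, Finset.sum_filter]
  refine Finset.sum_congr rfl fun d hd => ?_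
  have h : monomial d (P.coeff d) = P.coeff d • monomial d (1 : K) := by
    rw [smul_monomial, smul_eq_mul, mul_one]
  have hm := coeff_aeval_monomial_of_natDegree_le_one (K := K) hy d
  rw [h, map_smul, map_smul, Polynomial.coeff_smul]
  split_ifs with hdN
  · rw [← hm.2, hdN]
  · have hlt : d.degree < N := lt_of_le_of_ne (le_totalDegree hd) hdN
    rw [Polynomial.coeff_eq_zero_of_natDegree_lt (hm.1.trans_lt hlt), smul_zero]

/-- The substitution `X_t ↦ X_t + c_t T` (`t < m`), `X_m ↦ T`. -/
def shearPoly {m : ℕ} (c : Fin m → ℂ) (K : Type*) [Field K] [Algebra ℂ K] :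
    MvPolynomial (Fin (m + 1)) K →ₐ[K] Polynomial (MvPolynomial (Fin m) K) :=
  aeval (Fin.snoc (α := fun _ => Polynomial (MvPolynomial (Fin m) K))
    (fun t => Polynomial.C (X t) + Polynomial.C (C (algebraMap ℂ K (c t))) * Polynomial.X)
    Polynomial.X)

end LeadingCoefficient

lemma MvPolynomial.IsHomogeneous.eval_mul_left {K σ : Type*} [CommRing K] {N : ℕ}
    {h : MvPolynomial σ K} (hh : h.IsHomogeneous N) (r : K) (y : σ → K) :
    eval (fun s => r * y s) h = r ^ N * eval y h := by
  rw [eval_eq, eval_eq, Finset.mul_sum]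
  refine Finset.sum_congr rfl fun d hd => ?_
  have hdeg : ∑ s ∈ d.support, d s = N := (hh.degree_eq_sum_deg_support hd).symm
  simp only [mul_pow]
  rw [Finset.prod_mul_distrib, Finset.prod_pow_eq_pow_sum, hdeg]
  ring

/-- After a suitable shear with constant coefficients, a nonzero polynomial has a constant
leading coefficient in its last variable. -/
lemma exists_leadingCoeff_shearPoly {K : Type*} [Field K] [Algebra ℂ K] {m : ℕ}
    {B : MvPolynomial (Fin (m + 1)) K} (hB : B ≠ 0) :
    ∃ c : Fin m → ℂ, ∃ u : K, u ≠ 0 ∧ (shearPoly c K B).leadingCoeff = C u := by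
  classical
  have hshear : ∀ (c : Fin m → ℂ) (s : Fin (m + 1)),
      (Fin.snoc (α := fun _ => Polynomial (MvPolynomial (Fin m) K))
        (fun t => Polynomial.C (X t) + Polynomial.C (C (algebraMap ℂ K (c t))) * Polynomial.X)
        Polynomial.X s).natDegree ≤ 1 := by
    intro c s
    refine Fin.lastCases ?_ (fun t => ?_) s
    · simp
    · rw [Fin.snoc_castSucc]
      compute_degree
  set N := B.totalDegree with hN
  have hB0 : homogeneousComponent N B ≠ 0 := by
    obtain ⟨d, hd, hdN⟩ := Finset.exists_mem_eq_sup B.support (support_nonempty.2 hB)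
      (fun d : Fin (m + 1) →₀ ℕ => d.degree)
    intro h0
    have h1 : coeff d (homogeneousComponent N B) = coeff d B := by
      rw [coeff_homogeneousComponent, if_pos]
      exact hdN.symm
    rw [h0, coeff_zero] at h1
    exact mem_support_iff.1 hd h1.symm
  have hB1 : homogeneousComponent N B * X (Fin.last m) ≠ 0 := mul_ne_zero hB0 (X_ne_zero _)
  have hinj : Function.Injective (algebraMap ℂ K) := (algebraMap ℂ K).injective
  obtain ⟨y, hy⟩ : ∃ y : Fin (m + 1) → ℂ,
      eval (fun s => algebraMap ℂ K (y s)) (homogeneousComponent N B * X (Fin.last m)) ≠ 0 := by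
    by_contra! hcon
    refine hB1 (funext_set (fun _ => Set.range (algebraMap ℂ K))
      (fun _ => Set.infinite_range_of_injective hinj) fun x hx => ?_)
    choose y hy using fun s => hx s (Set.mem_univ s)
    rw [map_zero, ← hcon y]
    congr 2
    exact funext fun s => (hy s).symm
  rw [map_mul, eval_X] at hy
  have hyl : y (Fin.last m) ≠ 0 := fun h => hy (by rw [h, map_zero, mul_zero])
  refine ⟨fun t => (y (Fin.last m))⁻¹ * y t.castSucc,
    eval (fun s => algebraMap ℂ K ((y (Fin.last m))⁻¹) * algebraMap ℂ K (y s))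
      (homogeneousComponent N B), ?_⟩
  refine (fun hne => ⟨hne, ?_⟩) ?_
  · rw [(homogeneousComponent_isHomogeneous N B).eval_mul_left]
    refine mul_ne_zero (pow_ne_zero _ ?_) (left_ne_zero_of_mul hy)
    simpa using hyl
  · have hval := coeff_totalDegree_aeval_of_natDegree_le_one (hshear
      (fun t => (y (Fin.last m))⁻¹ * y t.castSucc)) B
    have hle : (shearPoly (fun t => (y (Fin.last m))⁻¹ * y t.castSucc) K B).natDegree ≤ N :=
      natDegree_aeval_le_of_natDegree_le_one (hshear _) B
    rw [← hN] at hval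
    have hval' : (shearPoly (fun t => (y (Fin.last m))⁻¹ * y t.castSucc) K B).coeff N =
        C (eval (fun s => algebraMap ℂ K ((y (Fin.last m))⁻¹) * algebraMap ℂ K (y s))
          (homogeneousComponent N B)) := by
      refine hval.trans ?_
      rw [← coe_aeval_eq_eval]
      refine Eq.trans ?_ (aeval_algebraMap_apply (MvPolynomial (Fin m) K) _ _)
      congr 2
      funext s
      refine Fin.lastCases ?_ (fun t => ?_) s
      · simp [hyl]
      · simp [Polynomial.coeff_C]
    rw [Polynomial.leadingCoeff, le_antisymm hle (Polynomial.le_natDegree_of_ne_zero ?_)]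
    · exact hval'
    · refine hval'.trans_ne ?_
      rwa [Ne, C_eq_zero]

section GenericShear

variable {n p : ℕ}

/-- The automorphism of `ℂ[𝔄]` subtracting `∑ c_t 𝔄_{k,t}` from the entries `𝔄_{k,j}`. -/
def columnShear (c : Fin n → ℂ) (j : Fin n) :
    MvPolynomial (Fin n × Fin n) ℂ →ₐ[ℂ] MvPolynomial (Fin n × Fin n) ℂ :=
  aeval fun kl => X kl - if kl.2 = j then ∑ t, C (c t) * X (kl.1, t) else 0

lemma columnShear_injective {c : Fin n → ℂ} {j : Fin n} (hc : c j = 0) :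
    Function.Injective (columnShear c j) := by
  have h : (columnShear (-c) j).comp (columnShear c j) = AlgHom.id ℂ _ := by
    refine algHom_ext fun kl => ?_
    obtain ⟨k, l⟩ := kl
    simp only [columnShear, AlgHom.comp_apply, aeval_X, map_sub, AlgHom.id_apply]
    by_cases hl : l = j
    · have hsum : ∀ t, aeval (fun kl : Fin n × Fin n => X kl - if kl.2 = j then
          ∑ t, C ((-c) t) * X (kl.1, t) else 0) (C (c t) * X (k, t) : MvPolynomial _ ℂ) =
          C (c t) * X (k, t) := by
        intro t
        by_cases ht : t = j
        · simp [ht, hc]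
        · simp [ht, algebraMap_eq]
      simp only [hl, if_true, map_sum, hsum]
      simp
    · simp [hl]
  intro a b hab
  have := congrArg (columnShear (-c) j) hab
  rwa [← AlgHom.comp_apply, ← AlgHom.comp_apply, h] at this

/-- The extension of `columnShear` to `K`. -/
def genShear {c : Fin n → ℂ} {j : Fin n} (hc : c j = 0) : GenField n →ₐ[ℂ] GenField n :=
  IsFractionRing.liftAlgHom (A := MvPolynomial (Fin n × Fin n) ℂ)
    (g := (IsScalarTower.toAlgHom ℂ (MvPolynomial (Fin n × Fin n) ℂ) (GenField n)).comp
      (columnShear c j))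
    ((IsFractionRing.injective _ _).comp (columnShear_injective hc))

lemma genShear_genEntry {c : Fin n → ℂ} {j : Fin n} (hc : c j = 0) (k l : Fin n) :
    genShear hc (genEntry n k l) = genEntry n k l -
      if l = j then ∑ t, algebraMap ℂ (GenField n) (c t) * genEntry n k t else 0 := by
  have h := IsFractionRing.lift_algebraMap (A := MvPolynomial (Fin n × Fin n) ℂ)
    (K := GenField n)
    (g := ((IsScalarTower.toAlgHom ℂ (MvPolynomial (Fin n × Fin n) ℂ) (GenField n)).comp
      (columnShear c j)).toRingHom)
    ((IsFractionRing.injective _ _).comp (columnShear_injective hc)) (X (k, l))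
  refine h.trans ?_
  simp only [columnShear, AlgHom.toRingHom_eq_coe, RingHom.coe_coe, AlgHom.comp_apply, aeval_X]
  split_ifs
  · simp [genEntry, IsScalarTower.algebraMap_apply ℂ (MvPolynomial (Fin n × Fin n) ℂ) (GenField n),
      algebraMap_eq]
  · simp [genEntry]

/-- The semilinear automorphism of `K[X]` compensating `genShear`, so that `𝔄 X` is fixed. -/
def coordShear {c : Fin n → ℂ} {j : Fin n} (hc : c j = 0) :
    MvPolynomial (Fin n) (GenField n) →ₐ[ℂ] MvPolynomial (Fin n) (GenField n) where
  __ := eval₂Hom ((C : GenField n →+* MvPolynomial (Fin n) (GenField n)).comp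
    (genShear hc).toRingHom) (fun t => X t + C (algebraMap ℂ (GenField n) (c t)) * X j)
  commutes' r := by
    simp [IsScalarTower.algebraMap_apply ℂ (GenField n) (MvPolynomial (Fin n) (GenField n)),
      algebraMap_eq]

lemma coordShear_X {c : Fin n → ℂ} {j : Fin n} (hc : c j = 0) (t : Fin n) :
    coordShear hc (X t) = X t + C (algebraMap ℂ (GenField n) (c t)) * X j :=
  eval₂Hom_X' _ _ _

lemma coordShear_C {c : Fin n → ℂ} {j : Fin n} (hc : c j = 0) (a : GenField n) :
    coordShear hc (C a) = C (genShear hc a) :=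
  eval₂Hom_C _ _ _

lemma applyMat_coordShear {c : Fin n → ℂ} {j : Fin n} (hc : c j = 0) :
    applyMat (coordShear hc ∘ fun kl : Fin n × Fin n => C (genEntry n kl.1 kl.2))
      (coordShear hc ∘ X) = applyMat (fun kl : Fin n × Fin n => C (genEntry n kl.1 kl.2)) X := by
  funext k
  simp only [applyMat, Function.comp_apply, coordShear_X, coordShear_C, genShear_genEntry,
    map_sub, sub_mul, Finset.sum_sub_distrib]
  have h : ∑ l, C (if l = j then ∑ t, algebraMap ℂ (GenField n) (c t) * genEntry n k t else 0) *
      ((X l : MvPolynomial (Fin n) (GenField n)) + C (algebraMap ℂ (GenField n) (c l)) * X j) =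
      ∑ t, C (genEntry n k t) * (C (algebraMap ℂ (GenField n) (c t)) * X j) := by
    rw [Finset.sum_eq_single_of_mem j (Finset.mem_univ j) (fun l _ hl => by simp [hl])]
    simp only [if_true, hc, map_zero, zero_mul, add_zero, map_sum, map_mul, Finset.sum_mul]
    exact Finset.sum_congr rfl fun t _ => by ring
  rw [h]
  simp only [mul_add, Finset.sum_add_distrib, add_sub_cancel_right]

lemma coordShear_genChange {c : Fin n → ℂ} {j : Fin n} (hc : c j = 0)
    (f : MvPolynomial (Fin n) ℤ) : coordShear hc (genChange f) = genChange f := by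
  rw [genChange_eq, map_aeval_applyMat, applyMat_coordShear]

lemma coordShear_pderiv_genChange {c : Fin n → ℂ} {j : Fin n} (hc : c j = 0)
    (F : Fin p → MvPolynomial (Fin n) ℤ) {i : ℕ} (hj : (j : ℕ) < i) (a : Fin p)
    (b : Fin (n - i)) :
    coordShear hc (pderiv (colIdx n i b) (genChange (F a))) =
      pderiv (colIdx n i b) (genChange (F a)) := by
  rw [pderiv_genChange, map_polarJac, polarJac, polarJac, applyMat_coordShear]
  refine Finset.sum_congr rfl fun k _ => ?_
  have hne : colIdx n i b ≠ j := fun h => by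
    have := congrArg Fin.val h
    simp only [colIdx] at this
    omega
  simp only [Function.comp_apply, coordShear_C, genShear_genEntry, hne, if_false, sub_zero]

lemma coordShear_mem_radical {c : Fin n → ℂ} {j : Fin n} (hc : c j = 0)
    (F : Fin p → MvPolynomial (Fin n) ℤ) {i : ℕ} (hj : (j : ℕ) < i)
    {P : MvPolynomial (Fin n) (GenField n)}
    (hP : P ∈ (polarIdealK (fun a => genChange (F a)) i).radical) :
    coordShear hc P ∈ (polarIdealK (fun a => genChange (F a)) i).radical := by
  obtain ⟨N, hN⟩ := hP
  refine ⟨N, ?_⟩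
  rw [← map_pow]
  suffices h : polarIdealK (fun a => genChange (F a)) i ≤
      (polarIdealK (fun a => genChange (F a)) i).comap (coordShear hc) from h hN
  refine Ideal.span_le.2 ?_
  rintro _ (⟨a, rfl⟩ | ⟨e, rfl⟩)
  · refine Ideal.mem_comap.2 ?_
    rw [coordShear_genChange]
    exact Ideal.subset_span (Or.inl ⟨a, rfl⟩)
  · refine Ideal.mem_comap.2 ?_
    rw [AlgHom.map_det]
    refine Ideal.subset_span (Or.inr ⟨e, ?_⟩)
    congr 1
    ext1 a b
    simp [coordShear_pderiv_genChange hc F hj]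

lemma polarIdealK_succ_le {R : Type*} [CommRing R] (G : Fin p → MvPolynomial (Fin n) R) (i : ℕ) :
    polarIdealK G (i + 1) ≤ polarIdealK G i := by
  refine Ideal.span_mono (Set.union_subset_union_right _ ?_)
  rintro _ ⟨e, rfl⟩
  refine ⟨⟨fun b => ⟨e b + 1, by have := (e b).isLt; omega⟩, fun a b hab => ?_⟩, ?_⟩
  · refine e.injective (Fin.ext ?_)
    simpa using hab
  · congr 2
    ext1 a
    funext b
    congr 2
    refine Fin.ext ?_
    change i + 1 + (e b : ℕ) = i + ((e b : ℕ) + 1)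
    omega

end GenericShear

section Iterated

variable (n : ℕ) (σ : Type*)

/-- The inclusion `ℂ[𝔄, X] → K[X]`. -/
def iterHom : MvPolynomial ((Fin n × Fin n) ⊕ σ) ℂ →ₐ[ℂ] MvPolynomial σ (GenField n) :=
  aeval (Sum.elim (fun kl => C (genEntry n kl.1 kl.2)) X)

lemma iterHom_injective : Function.Injective (iterHom n σ) := by
  have h : (iterHom n σ : MvPolynomial ((Fin n × Fin n) ⊕ σ) ℂ →+* MvPolynomial σ (GenField n)) =
      (map (algebraMap (MvPolynomial (Fin n × Fin n) ℂ) (GenField n))).comp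
        (((sumAlgEquiv ℂ σ (Fin n × Fin n)).toAlgHom.comp
          (rename (Sum.swap : (Fin n × Fin n) ⊕ σ → _))) : _ →+* _) := by
    refine ringHom_ext (fun r => ?_) (fun s => ?_)
    · simp [iterHom, IsScalarTower.algebraMap_apply ℂ (GenField n) (MvPolynomial σ (GenField n)),
        IsScalarTower.algebraMap_apply ℂ (MvPolynomial (Fin n × Fin n) ℂ) (GenField n),
        algebraMap_eq]
    · rcases s with s | s <;> simp [iterHom, genEntry]
  have h' : ⇑(iterHom n σ) = (map (algebraMap (MvPolynomial (Fin n × Fin n) ℂ) (GenField n))) ∘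
      (sumAlgEquiv ℂ σ (Fin n × Fin n)) ∘ (rename (Sum.swap : (Fin n × Fin n) ⊕ σ → _)) :=
    funext fun b => congrArg (fun φ => φ b) h
  rw [h']
  exact (map_injective _ (IsFractionRing.injective _ _)).comp
    ((sumAlgEquiv ℂ σ (Fin n × Fin n)).injective.comp
      (rename_injective _ Sum.swap_leftInverse.injective))

end Iterated

section GenericPoint

variable {n : ℕ} {E : Type*} [Field E] {σ : Type*}

/-- The coordinates of the generic point of the prime `𝔮`. -/
def primePoint (𝔮 : Ideal (MvPolynomial σ E)) [𝔮.IsPrime] (s : σ) :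
    FractionRing (MvPolynomial σ E ⧸ 𝔮) :=
  algebraMap (MvPolynomial σ E ⧸ 𝔮) _ (Ideal.Quotient.mk 𝔮 (X s))

lemma aeval_primePoint (𝔮 : Ideal (MvPolynomial σ E)) [𝔮.IsPrime] (P : MvPolynomial σ E) :
    aeval (primePoint 𝔮) P = algebraMap (MvPolynomial σ E ⧸ 𝔮) _ (Ideal.Quotient.mk 𝔮 P) := by
  have h : (aeval (primePoint 𝔮) : MvPolynomial σ E →ₐ[E] FractionRing (MvPolynomial σ E ⧸ 𝔮)) =
      (IsScalarTower.toAlgHom E (MvPolynomial σ E ⧸ 𝔮) _).comp (Ideal.Quotient.mkₐ E 𝔮) :=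
    algHom_ext fun s => by simp [primePoint]
  exact congrArg (fun φ => φ P) h

lemma aeval_primePoint_eq_zero (𝔮 : Ideal (MvPolynomial σ E)) [𝔮.IsPrime]
    (P : MvPolynomial σ E) : aeval (primePoint 𝔮) P = 0 ↔ P ∈ 𝔮 := by
  rw [aeval_primePoint, map_eq_zero_iff _ (IsFractionRing.injective _ _),
    Ideal.Quotient.eq_zero_iff_mem]

end GenericPoint

section NoetherPosition

variable {n p : ℕ} {F : Fin p → MvPolynomial (Fin n) ℤ}

lemma exists_rename_mem_of_polar_le
    (hsm : ∀ x : Fin n → ℂ, (∀ j, eval x (toC (F j)) = 0) →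
      (jacEval (fun j => toC (F j)) x).rank = p)
    {i : ℕ} (hi1 : 1 ≤ i) (hi : i ≤ n) {𝔮 : Ideal (MvPolynomial (Fin n) (GenField n))}
    (h𝔮 : 𝔮.IsPrime) (hle : polarIdealK (fun a => genChange (F a)) i ≤ 𝔮) :
    ∃ B : MvPolynomial (Fin i) (GenField n), B ≠ 0 ∧ rename (Fin.castLE hi) B ∈ 𝔮 := by
  obtain ⟨b, hb, hb0⟩ := exists_relation_of_polar hsm hi1 hi (x := primePoint 𝔮)
    (fun P hP => (aeval_primePoint_eq_zero 𝔮 P).2 (hle hP))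
  refine ⟨iterHom n (Fin i) b, (map_ne_zero_iff _ (iterHom_injective _ _)).2 hb, ?_⟩
  rw [← aeval_primePoint_eq_zero, aeval_rename, ← hb0]
  have h : ((aeval (primePoint 𝔮 ∘ Fin.castLE hi) : MvPolynomial (Fin i) (GenField n) →ₐ[_] _
      ).restrictScalars ℂ).comp (iterHom n (Fin i)) =
      aeval (Sum.elim (genMat n _) (primePoint 𝔮 ∘ Fin.castLE hi)) := by
    refine algHom_ext fun s => ?_
    rcases s with s | s <;> simp [iterHom, genMat]
  exact congrArg (fun φ => φ b) h

lemma exists_rename_mem_radical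
    (hsm : ∀ x : Fin n → ℂ, (∀ j, eval x (toC (F j)) = 0) →
      (jacEval (fun j => toC (F j)) x).rank = p)
    {i : ℕ} (hi1 : 1 ≤ i) (hi : i ≤ n) :
    ∃ B : MvPolynomial (Fin i) (GenField n), B ≠ 0 ∧
      rename (Fin.castLE hi) B ∈ (polarIdealK (fun a => genChange (F a)) i).radical := by
  classical
  set 𝒦 := polarIdealK (fun a => genChange (F a)) i with h𝒦
  have hfin := Ideal.finite_minimalPrimes_of_isNoetherianRing _ 𝒦
  choose! B hB hB𝔮 using fun (𝔮 : Ideal (MvPolynomial (Fin n) (GenField n)))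
    (h : 𝔮 ∈ 𝒦.minimalPrimes) => exists_rename_mem_of_polar_le hsm hi1 hi h.1.1 h.1.2
  refine ⟨∏ 𝔮 ∈ hfin.toFinset, B 𝔮, Finset.prod_ne_zero_iff.2 fun 𝔮 h =>
    hB 𝔮 (hfin.mem_toFinset.1 h), ?_⟩
  rw [← Ideal.sInf_minimalPrimes, Submodule.mem_sInf, map_prod]
  intro 𝔮 h
  rw [← Finset.mul_prod_erase _ _ (hfin.mem_toFinset.2 h)]
  exact Ideal.mul_mem_right _ _ (hB𝔮 𝔮 h)

/-- The map `K[X₁, …, X_m] → K[X] / √𝒦_i`. -/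
def coordHom (F : Fin p → MvPolynomial (Fin n) ℤ) (i : ℕ) {m : ℕ} (hm : m ≤ n) :
    MvPolynomial (Fin m) (GenField n) →+*
      MvPolynomial (Fin n) (GenField n) ⧸ (polarIdealK (fun a => genChange (F a)) i).radical :=
  (Ideal.Quotient.mk _).comp (rename (Fin.castLE hm)).toRingHom

lemma isIntegral_of_forall_isIntegralElem {R R' B : Type*} [CommRing R] [CommRing R']
    [CommRing B] {f : R →+* B} {g : R' →+* B} (hg : g.IsIntegral)
    (h : ∀ r, f.IsIntegralElem (g r)) : f.IsIntegral := by
  let _ := f.toAlgebra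
  let g' : R' →+* integralClosure R B := g.codRestrict (integralClosure R B).toSubring h
  intro b
  obtain ⟨P, hP, hPb⟩ := hg b
  have : IsIntegral (integralClosure R B) b := ⟨P.map g', hP.map g', by
    rw [Polynomial.eval₂_map]; exact hPb⟩
  exact isIntegral_trans (R := R) (A := integralClosure R B) b this

lemma isIntegralElem_coordHom_X
    (hsm : ∀ x : Fin n → ℂ, (∀ j, eval x (toC (F j)) = 0) →
      (jacEval (fun j => toC (F j)) x).rank = p)
    {m : ℕ} (hm : m + 1 ≤ n) :
    (coordHom F (m + 1) (Nat.le_of_succ_le hm)).IsIntegralElem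
      (Ideal.Quotient.mk _ (X ⟨m, hm⟩)) := by
  obtain ⟨B, hB, hBmem⟩ := exists_rename_mem_radical hsm (Nat.le_add_left 1 m) hm
  obtain ⟨c, u, hu, hlead⟩ := exists_leadingCoeff_shearPoly hB
  let c' : Fin n → ℂ := fun t => if h : (t : ℕ) < m then c ⟨t, h⟩ else 0
  have hc' : c' ⟨m, hm⟩ = 0 := by simp [c']
  have hmem := coordShear_mem_radical hc' F (Nat.lt_succ_self m) hBmem
  have hshear : (coordShear hc' : _ →+* _).comp (rename (Fin.castLE hm)).toRingHom =
      ((Polynomial.eval₂RingHom ((rename (Fin.castLE (Nat.le_of_succ_le hm))).toRingHom.comp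
        (map (genShear hc' : GenField n →+* GenField n))) (X ⟨m, hm⟩)).comp
          (shearPoly c (GenField n)).toRingHom) := by
    refine ringHom_ext (fun r => ?_) (fun s => ?_)
    · have h1 : shearPoly c (GenField n) (C r) = Polynomial.C (C r) := by
        rw [← algebraMap_eq, AlgHom.commutes]; rfl
      simp [h1, coordShear_C]
    · refine Fin.lastCases ?_ (fun t => ?_) s
      · simp only [RingHom.comp_apply, AlgHom.toRingHom_eq_coe, RingHom.coe_coe, rename_X,
          coordShear_X]
        have : Fin.castLE hm (Fin.last m) = ⟨m, hm⟩ := rfl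
        simp [this, hc', shearPoly]
      · have : c' (Fin.castLE hm t.castSucc) = c t := by simp [c']
        simp only [RingHom.comp_apply, AlgHom.toRingHom_eq_coe, RingHom.coe_coe, rename_X,
          coordShear_X, this]
        simp [shearPoly]
  set Q := (shearPoly c (GenField n) B).map (map (genShear hc' : GenField n →+* GenField n))
    with hQ
  have hinj : Function.Injective (map (σ := Fin m) (genShear hc' : GenField n →+* GenField n)) :=
    map_injective _ (RingHom.injective _)
  have hu' : genShear hc' u ≠ 0 := (map_ne_zero _).2 hu
  have hQlead : Q.leadingCoeff = C (genShear hc' u) := by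
    rw [hQ, Polynomial.leadingCoeff_map_of_injective hinj, hlead]
    simp
  refine ⟨Polynomial.C (C (genShear hc' u)⁻¹) * Q, ?_, ?_⟩
  · refine Polynomial.monic_C_mul_of_mul_leadingCoeff_eq_one ?_
    rw [hQlead, ← C_mul, inv_mul_cancel₀ hu', C_1]
  · rw [Polynomial.eval₂_mul]
    refine mul_eq_zero_of_right _ ?_
    have h := congrArg (fun φ => φ B) hshear
    rw [hQ, Polynomial.eval₂_map, coordHom, RingHom.comp_assoc, ← Polynomial.hom_eval₂,
      Ideal.Quotient.eq_zero_iff_mem]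
    simp only [RingHom.comp_apply, Polynomial.coe_eval₂RingHom] at h
    exact h ▸ hmem

theorem isIntegral_coordHom
    (hsm : ∀ x : Fin n → ℂ, (∀ j, eval x (toC (F j)) = 0) →
      (jacEval (fun j => toC (F j)) x).rank = p)
    {m : ℕ} (hm : m ≤ n) : (coordHom F (m + 1) hm).IsIntegral := by
  induction hm using Nat.decreasingInduction with
  | self =>
    refine RingHom.isIntegral_of_surjective _ ?_
    refine Ideal.Quotient.mk_surjective.comp ?_
    intro P
    exact ⟨P, by simp⟩
  | of_succ m hm ih =>
    have hle := Ideal.radical_mono (polarIdealK_succ_le (fun a => genChange (F a)) (m + 1))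
    have ih' : (coordHom F (m + 1) hm).IsIntegral := by
      intro b
      obtain ⟨b, rfl⟩ := Ideal.Quotient.mk_surjective b
      exact (ih (Ideal.Quotient.mk _ b)).map (Ideal.Quotient.factor hle)
    refine isIntegral_of_forall_isIntegralElem ih' fun r => ?_
    induction r using MvPolynomial.induction_on with
    | C a =>
      have : coordHom F (m + 1) hm (C a) =
        coordHom F (m + 1) (Nat.le_of_succ_le hm) (C a) := by simp [coordHom]
      rw [this]
      exact RingHom.isIntegralElem_map _
    | add P Q hP hQ => rw [map_add]; exact RingHom.IsIntegralElem.add _ hP hQ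
    | mul_X P s hP =>
      rw [map_mul]
      refine RingHom.IsIntegralElem.mul _ hP ?_
      refine Fin.lastCases ?_ (fun t => ?_) s
      · have : coordHom F (m + 1) hm (X (Fin.last m)) = Ideal.Quotient.mk _ (X ⟨m, hm⟩) := by
          simp [coordHom]
          rfl
        rw [this]
        exact isIntegralElem_coordHom_X hsm hm
      · have : coordHom F (m + 1) hm (X t.castSucc) =
          coordHom F (m + 1) (Nat.le_of_succ_le hm) (X t) := by simp [coordHom]
        rw [this]
        exact RingHom.isIntegralElem_map _

end NoetherPosition

section RowMultipliers

variable {p : ℕ} {S T : Type*} [CommRing S] [Algebra ℂ S]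

/-- The multipliers starting with the rows `α t`. -/
def rowBase (α : T → Fin p) (t : T) : Fin p → ℂ := Pi.single (α t) 1

/-- The multiplier directions given by the rows in `I`. -/
def rowDir (I : Finset (Fin p)) (b : I) : Fin p → ℂ := Pi.single b.1 1

lemma sum_multiplier_row_mul (α : T → Fin p) (I : Finset (Fin p)) (v : T × I → S) (t : T)
    (N : Fin p → S) :
    ∑ a, multiplier (rowBase α) (rowDir I) v t a * N a =
      N (α t) + ∑ b : I, v (t, b) * N b := by
  simp only [multiplier, add_mul, Finset.sum_add_distrib, Finset.sum_mul, rowBase, rowDir]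
  rw [Finset.sum_comm]
  congr 1
  · rw [Finset.sum_eq_single (α t) (fun a _ ha => by simp [ha]) (by simp)]
    simp
  · refine Finset.sum_congr rfl fun b _ => ?_
    rw [Finset.sum_eq_single b.1 (fun a _ ha => by simp [ha]) (by simp)]
    simp

lemma multiplier_row_apply [DecidableEq T] {α : T → Fin p} (hα : Function.Injective α)
    {I : Finset (Fin p)} (hI : ∀ t, α t ∉ I) (v : T × I → S) (t t' : T) :
    multiplier (rowBase α) (rowDir I) v t (α t') = if t' = t then 1 else 0 := by
  have h : ∀ b : I, α t' ≠ b := fun b hb => hI t' (hb ▸ b.2)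
  simp only [multiplier, rowBase, rowDir, Pi.single_apply, h, hα.eq_iff, if_false, map_zero,
    mul_zero, Finset.sum_const_zero, add_zero]
  split_ifs <;> simp

end RowMultipliers

section Dimension

variable {n p : ℕ} {F : Fin p → MvPolynomial (Fin n) ℤ}

lemma aeval_polarSystem_coord {T m : Type*} [Fintype T] [Fintype m]
    (f : Fin p → MvPolynomial (Fin n) ℂ) (i : ℕ)
    (κ₀ : T → Fin p → ℂ) (κ : m → Fin p → ℂ) {L : Type*} [Field L] [Algebra ℂ L]
    [Algebra (GenField n) L] [IsScalarTower ℂ (GenField n) L] (y : Fin n ⊕ (T × m) → L)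
    (j : Fin p ⊕ (T × Fin (n - i))) :
    aeval y (polarSystem f i κ₀ κ (Sum.elim (fun kl => C (genEntry n kl.1 kl.2)) X :
      _ → MvPolynomial (Fin n ⊕ (T × m)) (GenField n)) j) =
      polarSystem f i κ₀ κ (Sum.elim (genMat n L) y) j := by
  refine (map_polarSystem ((aeval y : MvPolynomial (Fin n ⊕ (T × m)) (GenField n) →ₐ[_] L
    ).restrictScalars ℂ) f i κ₀ κ _ j).trans ?_
  congr 1
  funext s
  rcases s with s | s <;> simp [genMat]

lemma map_polarJac_genMat {L L' : Type*} [Field L] [Algebra ℂ L] [Algebra (GenField n) L]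
    [IsScalarTower ℂ (GenField n) L] [Field L'] [Algebra ℂ L'] [Algebra (GenField n) L']
    [IsScalarTower ℂ (GenField n) L'] (ψ : L →ₐ[GenField n] L')
    (f : Fin p → MvPolynomial (Fin n) ℂ) (i : ℕ) (x : Fin n → L) (a : Fin p) (c : Fin (n - i)) :
    ψ (polarJac f i (genMat n L) x a c) = polarJac f i (genMat n L') (ψ ∘ x) a c := by
  refine (map_polarJac (ψ.restrictScalars ℂ) f i (genMat n L) x a c).trans ?_
  congr 1
  funext kl
  simp [genMat]

lemma eq_of_sum_mul_map_eq {L L' ι κ : Type*} [Field L] [Field L'] [Fintype ι] [Fintype κ]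
    (ψ : L →+* L') {M : ι → κ → L} (hM : LinearIndependent L M) {s t : ι → L'}
    (h : ∀ c, ∑ b, s b * ψ (M b c) = ∑ b, t b * ψ (M b c)) : s = t := by
  classical
  funext b₀
  obtain ⟨r, hr⟩ := exists_sum_mul_eq_of_rows (M := M) (fun u hu => funext
    (Fintype.linearIndependent_iff.1 hM u (funext fun c => by simpa using hu c)))
    (Pi.single b₀ 1)
  have key : ∀ u : ι → L', ∑ c, (∑ b, u b * ψ (M b c)) * ψ (r c) = u b₀ := by
    intro u
    simp only [Finset.sum_mul]
    rw [Finset.sum_comm]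
    have : ∀ b, ∑ c, u b * ψ (M b c) * ψ (r c) = u b * ψ ((Pi.single b₀ 1 : ι → L) b) := by
      intro b
      rw [← hr b, map_sum, Finset.mul_sum]
      exact Finset.sum_congr rfl fun c _ => by rw [map_mul]; ring
    simp only [this]
    rw [Finset.sum_eq_single b₀ (fun b _ hb => by simp [hb]) (by simp)]
    simp
  rw [← key s, ← key t]
  exact Finset.sum_congr rfl fun c _ => by rw [h c]

lemma exists_algHom_primePoint {E σ L' : Type*} [Field E] [Field L'] [Algebra E L']
    (𝔮 : Ideal (MvPolynomial σ E)) [𝔮.IsPrime] (x' : σ → L')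
    (h : ∀ P : MvPolynomial σ E, aeval x' P = 0 ↔ P ∈ 𝔮) :
    ∃ ψ : FractionRing (MvPolynomial σ E ⧸ 𝔮) →ₐ[E] L', ψ ∘ primePoint 𝔮 = x' := by
  let ψ₀ : (MvPolynomial σ E ⧸ 𝔮) →ₐ[E] L' :=
    Ideal.Quotient.liftₐ 𝔮 (aeval x') fun P hP => (h P).2 hP
  have hψ₀ : Function.Injective ψ₀ := by
    rw [injective_iff_map_eq_zero]
    intro P hP
    obtain ⟨P, rfl⟩ := Ideal.Quotient.mk_surjective P
    exact Ideal.Quotient.eq_zero_iff_mem.2 ((h P).1 hP)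
  refine ⟨IsFractionRing.liftAlgHom (K := FractionRing (MvPolynomial σ E ⧸ 𝔮)) hψ₀, ?_⟩
  funext s
  refine (IsFractionRing.lift_algebraMap (K := FractionRing (MvPolynomial σ E ⧸ 𝔮))
    (g := ψ₀.toRingHom) hψ₀ _).trans ?_
  exact aeval_X _ _

/-- The system cutting out the locus where the row `a₀` of the truncated Jacobian matrix depends
on the rows in `I`. -/
def rowSystem (f : Fin p → MvPolynomial (Fin n) ℂ) (i : ℕ) (I : Finset (Fin p)) (a₀ : Fin p) :
    Fin p ⊕ (Unit × Fin (n - i)) → MvPolynomial (Fin n ⊕ (Unit × I)) (GenField n) :=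
  polarSystem f i (rowBase fun _ => a₀) (rowDir I)
    (Sum.elim (fun kl => C (genEntry n kl.1 kl.2)) X)

section RowSystem

variable {L : Type*} [Field L] [Algebra ℂ L] [Algebra (GenField n) L]
  [IsScalarTower ℂ (GenField n) L]

lemma forall_aeval_rowSystem_eq_zero (f : Fin p → MvPolynomial (Fin n) ℂ) (i : ℕ)
    (I : Finset (Fin p)) (a₀ : Fin p) (x : Fin n → L) (v : Unit × I → L) :
    (∀ j, aeval (Sum.elim x v) (rowSystem f i I a₀ j) = 0) ↔
      (∀ a, aeval (applyMat (genMat n L) x) (f a) = 0) ∧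
      ∀ c, polarJac f i (genMat n L) x a₀ c +
        ∑ b : I, v ((), b) * polarJac f i (genMat n L) x b c = 0 := by
  simp only [rowSystem, aeval_polarSystem_coord]
  rw [Sum.forall]
  refine and_congr Iff.rfl ?_
  rw [Prod.forall]
  refine Unique.forall_iff.trans (forall_congr' fun c => ?_)
  rw [← sum_multiplier_row_mul (fun _ : Unit => a₀) I v () (fun a => polarJac f i _ x a c)]
  rfl

lemma polar_aeval_eq_zero_of_rowSystem {i : ℕ} {I : Finset (Fin p)} {a₀ : Fin p} (ha₀ : a₀ ∉ I)
    {x : Fin n → L} {v : Unit × I → L}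
    (h : ∀ j, aeval (Sum.elim x v) (rowSystem (fun a => toC (F a)) i I a₀ j) = 0) :
    ∀ P ∈ polarIdealK (fun a => genChange (F a)) i, aeval x P = 0 := by
  obtain ⟨h1, h2⟩ := (forall_aeval_rowSystem_eq_zero _ i I a₀ x v).1 h
  refine (polarIdealK_le_ker_iff F i x).2 ⟨h1,
    multiplier (rowBase fun _ : Unit => a₀) (rowDir I) v (), fun h0 => ?_, fun c => ?_⟩
  · have h1 := multiplier_row_apply (α := fun _ : Unit => a₀)
      (Function.injective_of_subsingleton _) (fun _ => ha₀) v () ()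
    rw [h0] at h1
    simp at h1
  · rw [sum_multiplier_row_mul (fun _ : Unit => a₀) I v () (fun a => polarJac _ i _ x a c)]
    exact h2 c

end RowSystem

lemma ker_mem_minimalPrimes_rowSystem {i : ℕ} {𝔮 : Ideal (MvPolynomial (Fin n) (GenField n))}
    [𝔮.IsPrime] (h𝔮 : 𝔮 ∈ (polarIdealK (fun a => genChange (F a)) i).minimalPrimes)
    {I : Finset (Fin p)}
    (hI : LinearIndependent (FractionRing (MvPolynomial (Fin n) (GenField n) ⧸ 𝔮)) fun a : I =>
      polarJac (fun a => toC (F a)) i (genMat n _) (primePoint 𝔮) a)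
    {a₀ : Fin p} (ha₀ : a₀ ∉ I)
    {v : Unit × I → FractionRing (MvPolynomial (Fin n) (GenField n) ⧸ 𝔮)}
    (hv : ∀ j, aeval (Sum.elim (primePoint 𝔮) v) (rowSystem (fun a => toC (F a)) i I a₀ j) = 0) :
    RingHom.ker (aeval (Sum.elim (primePoint 𝔮) v) : _ →ₐ[GenField n] _) ∈
      (Ideal.span (Set.range (rowSystem (fun a => toC (F a)) i I a₀))).minimalPrimes := by
  refine ⟨⟨RingHom.ker_isPrime _, Ideal.span_le.2 ?_⟩, fun 𝔯 h𝔯 hle => ?_⟩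
  · rintro _ ⟨j, rfl⟩
    exact hv j
  obtain ⟨h𝔯p, hg𝔯⟩ := h𝔯
  obtain ⟨x', hx'⟩ : ∃ x', x' = primePoint 𝔯 ∘ Sum.inl := ⟨_, rfl⟩
  obtain ⟨v', hv'⟩ : ∃ v', v' = primePoint 𝔯 ∘ Sum.inr := ⟨_, rfl⟩
  have hy' : Sum.elim x' v' = primePoint 𝔯 := by
    rw [hx', hv']; exact Sum.elim_comp_inl_inr _
  have hsys : ∀ j, aeval (Sum.elim x' v') (rowSystem (fun a => toC (F a)) i I a₀ j) = 0 := by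
    intro j
    rw [hy', aeval_primePoint_eq_zero]
    exact hg𝔯 (Ideal.subset_span ⟨j, rfl⟩)
  have hx'0 := polar_aeval_eq_zero_of_rowSystem ha₀ hsys
  have hker' : ∀ P, aeval x' P = 0 → P ∈ 𝔮 := fun P hP => by
    have h1 : rename Sum.inl P ∈ 𝔯 := by
      rw [← aeval_primePoint_eq_zero, aeval_rename, ← hx']
      exact hP
    have h2 : aeval (Sum.elim (primePoint 𝔮) v) (rename Sum.inl P) = 0 := hle h1
    rw [aeval_rename, Sum.elim_comp_inl] at h2
    exact (aeval_primePoint_eq_zero 𝔮 P).1 h2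
  have hker : 𝔮 ≤ RingHom.ker (aeval x' : _ →ₐ[GenField n] _) :=
    h𝔮.2 ⟨RingHom.ker_isPrime _, hx'0⟩ fun P hP => hker' P hP
  obtain ⟨ψ, hψ⟩ := exists_algHom_primePoint 𝔮 x' fun P => ⟨hker' P, fun hP => hker hP⟩
  have h1 := ((forall_aeval_rowSystem_eq_zero _ i I a₀ _ v).1 hv).2
  have h2 := ((forall_aeval_rowSystem_eq_zero _ i I a₀ _ v').1 hsys).2
  have hψv : (fun b : I => ψ (v ((), b))) = fun b => v' ((), b) := by
    refine eq_of_sum_mul_map_eq (ψ : _ →+* _) hI fun c => ?_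
    have h1c := congrArg ψ (h1 c)
    rw [map_add, map_sum, map_zero, map_polarJac_genMat, hψ] at h1c
    have h2c := h2 c
    rw [add_eq_zero_iff_neg_eq] at h1c h2c
    refine Eq.trans ?_ (h1c.symm.trans (h2c.trans ?_))
    · exact Finset.sum_congr rfl fun b _ => (map_mul ψ _ _).symm
    · refine Finset.sum_congr rfl fun b _ => ?_
      rw [← hψ, ← map_polarJac_genMat]
      rfl
  intro P hP
  rw [← aeval_primePoint_eq_zero, ← hy']
  have : Sum.elim x' v' = ψ ∘ Sum.elim (primePoint 𝔮) v := by
    rw [Sum.comp_elim, hψ]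
    congr 1
    funext tb
    exact (congrFun hψv tb.2).symm
  have hP' : aeval (Sum.elim (primePoint 𝔮) v) P = 0 := hP
  have h3 : aeval (ψ ∘ Sum.elim (primePoint 𝔮) v) P = ψ (aeval (Sum.elim (primePoint 𝔮) v) P) :=
    (congrArg (fun φ => φ P) (comp_aeval (Sum.elim (primePoint 𝔮) v) ψ)).symm
  rw [this, h3, hP', map_zero]

/-- Lower bound for the dimension of a component of the polar variety on which the truncated
Jacobian matrix has rank `I.card`. -/
lemma card_le_trdeg_of_row_basis {i : ℕ} {𝔮 : Ideal (MvPolynomial (Fin n) (GenField n))}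
    [𝔮.IsPrime] (h𝔮 : 𝔮 ∈ (polarIdealK (fun a => genChange (F a)) i).minimalPrimes)
    {I : Finset (Fin p)}
    (hI : LinearIndependent (FractionRing (MvPolynomial (Fin n) (GenField n) ⧸ 𝔮)) fun a : I =>
      polarJac (fun a => toC (F a)) i (genMat n _) (primePoint 𝔮) a)
    {a₀ : Fin p} (ha₀ : a₀ ∉ I) {U : I → FractionRing (MvPolynomial (Fin n) (GenField n) ⧸ 𝔮)}
    (hU : ∀ c, polarJac (fun a => toC (F a)) i (genMat n _) (primePoint 𝔮) a₀ c =
      ∑ b : I, U b * polarJac (fun a => toC (F a)) i (genMat n _) (primePoint 𝔮) b c) :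
    ((n + I.card : ℕ) : Cardinal) ≤ (p + (n - i) : ℕ) + Algebra.trdeg (GenField n)
      (FractionRing (MvPolynomial (Fin n) (GenField n) ⧸ 𝔮)) := by
  have hxle : ∀ P ∈ polarIdealK (fun a => genChange (F a)) i, aeval (primePoint 𝔮) P = 0 :=
    fun P hP => (aeval_primePoint_eq_zero 𝔮 P).2 (h𝔮.1.2 hP)
  obtain ⟨hx0, -⟩ := (polarIdealK_le_ker_iff F i (primePoint 𝔮)).1 hxle
  have hv := (forall_aeval_rowSystem_eq_zero (fun a => toC (F a)) i I a₀ (primePoint 𝔮)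
    fun tb => - U tb.2).2 ⟨hx0, fun c => by
      rw [hU c, ← Finset.sum_add_distrib]
      exact Finset.sum_eq_zero fun b _ => by ring⟩
  have hfin := card_le_add_trdeg_of_mem_minimalPrimes _ _
    (ker_mem_minimalPrimes_rowSystem h𝔮 hI ha₀ hv)
  refine le_trans (le_of_eq ?_) (hfin.trans (add_le_add (le_of_eq ?_)
    (trdeg_le_of_injective (Ideal.kerLiftAlg _) (Ideal.kerLiftAlg_injective _))))
  · simp
  · simp

end Dimension

section Transcendence

open Algebra

universe u

lemma trdeg_fractionRing (E S : Type u) [Field E] [CommRing S] [IsDomain S] [Algebra E S] :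
    Algebra.trdeg E (FractionRing S) = Algebra.trdeg E S := by
  have : Algebra.IsAlgebraic S (FractionRing S) :=
    IsLocalization.isAlgebraic _ (nonZeroDivisors S)
  rw [← trdeg_add_eq E S (A := FractionRing S),
    trdeg_eq_zero (R := S), add_zero]

/-- A transcendence basis consisting of coordinates. -/
lemma exists_coord_algebraicIndependent {E : Type} [Field E] {n : ℕ}
    (𝔮 : Ideal (MvPolynomial (Fin n) E)) [𝔮.IsPrime] :
    ∃ (k : ℕ) (z : Fin k → Fin n), AlgebraicIndependent E (primePoint 𝔮 ∘ z) ∧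
      (k : Cardinal) = Algebra.trdeg E (FractionRing (MvPolynomial (Fin n) E ⧸ 𝔮)) := by
  let xS : Fin n → MvPolynomial (Fin n) E ⧸ 𝔮 := fun s => Ideal.Quotient.mk 𝔮 (X s)
  have htop : Algebra.adjoin E (Set.range xS) = ⊤ := by
    have h : (Ideal.Quotient.mkₐ E 𝔮) = aeval xS := algHom_ext fun s => by simp [xS]
    rw [Algebra.adjoin_range_eq_range_aeval, ← h, AlgHom.range_eq_top]
    exact Ideal.Quotient.mk_surjective
  have : Algebra.IsAlgebraic (Algebra.adjoin E (Set.range xS)) (MvPolynomial (Fin n) E ⧸ 𝔮) := by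
    refine ⟨fun a => ?_⟩
    exact isAlgebraic_algebraMap (⟨a, htop ▸ Algebra.mem_top⟩ : Algebra.adjoin E (Set.range xS))
  obtain ⟨t, ht, hbas⟩ := exists_isTranscendenceBasis_subset (R := E) (Set.range xS)
  have hfin : Finite t := (Set.finite_range xS).subset ht
  choose g hg using fun a : t => ht a.2
  refine ⟨Nat.card t, g ∘ (Finite.equivFin t).symm, ?_, ?_⟩
  · have h := (hbas.1.comp _ (Finite.equivFin t).symm.injective).map'
      (f := IsScalarTower.toAlgHom E _ (FractionRing (MvPolynomial (Fin n) E ⧸ 𝔮)))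
      (IsFractionRing.injective _ _)
    convert h using 1
    funext a
    simp only [Function.comp_apply, primePoint, IsScalarTower.coe_toAlgHom']
    congr 1
    exact hg _
  · rw [trdeg_fractionRing, ← hbas.cardinalMk_eq_trdeg, Nat.cast_card]

lemma injective_of_isIntegral_of_le_trdeg {E S : Type} [Field E] [CommRing S] [IsDomain S]
    [Algebra E S] {m : ℕ} (φ : MvPolynomial (Fin m) E →ₐ[E] S) (h_int : φ.toRingHom.IsIntegral)
    (hle : (m : Cardinal) ≤ Algebra.trdeg E S) : Function.Injective φ := by
  let xS : Fin m → S := fun s => φ (X s)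
  have hxS : φ = aeval xS := algHom_ext fun s => by simp [xS]
  have halg : Algebra.IsAlgebraic (Algebra.adjoin E (Set.range xS)) S := by
    refine ⟨fun b => IsIntegral.isAlgebraic ?_⟩
    obtain ⟨P, hP, hPb⟩ := h_int b
    have hmem : ∀ r, φ r ∈ Algebra.adjoin E (Set.range xS) := by
      intro r
      rw [hxS, Algebra.adjoin_range_eq_range_aeval]
      exact ⟨r, rfl⟩
    let g := φ.codRestrict _ hmem
    exact ⟨P.map g.toRingHom, hP.map _, by rw [Polynomial.eval₂_map]; exact hPb⟩
  have hbas := Algebra.IsAlgebraic.isTranscendenceBasis_of_le_trdeg_of_finite E xS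
    (by simpa using hle)
  rw [hxS]
  exact hbas.1

end Transcendence

section Dimension

variable {n p : ℕ} {F : Fin p → MvPolynomial (Fin n) ℤ}

lemma exists_not_mem_of_polar {i : ℕ} {L : Type*} [Field L] [Algebra ℂ L] [Algebra (GenField n) L]
    [IsScalarTower ℂ (GenField n) L] {x : Fin n → L}
    (hx : ∀ P ∈ polarIdealK (fun a => genChange (F a)) i, aeval x P = 0) {I : Finset (Fin p)}
    (hI : LinearIndependent L fun a : I =>
      polarJac (fun a => toC (F a)) i (genMat n L) x a) : ∃ a, a ∉ I := by
  by_contra! h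
  obtain ⟨-, w, hw, hker⟩ := (polarIdealK_le_ker_iff F i x).1 hx
  refine hw (funext fun a => ?_)
  refine Fintype.linearIndependent_iff.1 hI (fun a => w a) ?_ ⟨a, h a⟩
  funext c
  refine Eq.trans ?_ (hker c)
  rw [Finset.sum_apply, ← Finset.sum_subset (Finset.subset_univ I) fun a _ ha => (ha (h a)).elim]
  exact Finset.sum_coe_sort I fun a => w a * polarJac (fun a => toC (F a)) i (genMat n L) x a c

lemma algebraicIndependent_card_le
    (hsm : ∀ x : Fin n → ℂ, (∀ j, eval x (toC (F j)) = 0) →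
      (jacEval (fun j => toC (F j)) x).rank = p)
    {i : ℕ} {L : Type*} [Field L] [Algebra ℂ L] [Algebra (GenField n) L]
    [IsScalarTower ℂ (GenField n) L] {x : Fin n → L}
    (hx : ∀ a, aeval (applyMat (genMat n L) x) (toC (F a)) = 0) {I : Finset (Fin p)}
    {T : Type*} [Fintype T] [DecidableEq T] {α : T → Fin p} (hα : Function.Injective α)
    (hαI : ∀ t, α t ∉ I) {U : T → I → L}
    (hU : ∀ t c, polarJac (fun a => toC (F a)) i (genMat n L) x (α t) c =
      ∑ b : I, U t b * polarJac (fun a => toC (F a)) i (genMat n L) x b c)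
    (hn : 0 < n) {k : ℕ} {z : Fin k → Fin n} (hz : AlgebraicIndependent (GenField n) (x ∘ z)) :
    k + p + Fintype.card T * (n - i) ≤ n + Fintype.card T * I.card := by
  classical
  by_contra! hlt
  have hsmooth := isSmoothZero_of_multipliers hsm i (rowBase α) (rowDir I) (x := x)
    (v := fun tb => - U tb.1 tb.2) hx
    (fun t c => by
      rw [sum_multiplier_row_mul α I (fun tb => - U tb.1 tb.2) t
        (fun a => polarJac (fun a => toC (F a)) i (genMat n L) x a c)]
      rw [hU t c, ← Finset.sum_add_distrib]
      exact Finset.sum_eq_zero fun b _ => by ring)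
    (fun s hs => funext fun t => by
      have := hs (α t)
      simpa [multiplier_row_apply hα hαI] using this)
  have : Nonempty (Fin n) := ⟨⟨0, hn⟩⟩
  have : Infinite L := Infinite.of_injective _ (FaithfulSMul.algebraMap_injective ℂ L)
  obtain ⟨b, hb, hb0⟩ := exists_ne_zero_aeval_eq_zero
    (τ := (Fin n × Fin n) ⊕ Fin k) (by
      simp only [Fintype.card_sum, Fintype.card_prod, Fintype.card_fin, Fintype.card_coe]
      omega) hsmooth (Sum.map id (Sum.inl ∘ z))
  refine hb (iterHom_injective n (Fin k) ?_)
  rw [map_zero]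
  refine (injective_iff_map_eq_zero _).1 hz _ ?_
  rw [← hb0]
  have h : ((aeval (x ∘ z) : MvPolynomial (Fin k) (GenField n) →ₐ[_] _
      ).restrictScalars ℂ).comp (iterHom n (Fin k)) =
      aeval (Sum.elim (genMat n L) (Sum.elim x fun tb : T × I => - U tb.1 tb.2) ∘
        (Sum.map id (Sum.inl ∘ z))) := by
    refine algHom_ext fun s => ?_
    rcases s with s | s <;> simp [iterHom, genMat]
  exact congrArg (fun φ => φ b) h

/-- Every component of the polar variety has dimension at least `i - 1`. -/
theorem le_trdeg_of_mem_minimalPrimes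
    (hsm : ∀ x : Fin n → ℂ, (∀ j, eval x (toC (F j)) = 0) →
      (jacEval (fun j => toC (F j)) x).rank = p)
    {m : ℕ} (hm : m + p ≤ n) (hn : 0 < n) {𝔮 : Ideal (MvPolynomial (Fin n) (GenField n))}
    [𝔮.IsPrime] (h𝔮 : 𝔮 ∈ (polarIdealK (fun a => genChange (F a)) (m + 1)).minimalPrimes) :
    (m : Cardinal) ≤ Algebra.trdeg (GenField n)
      (FractionRing (MvPolynomial (Fin n) (GenField n) ⧸ 𝔮)) := by
  classical
  have hxle : ∀ P ∈ polarIdealK (fun a => genChange (F a)) (m + 1), aeval (primePoint 𝔮) P = 0 :=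
    fun P hP => (aeval_primePoint_eq_zero 𝔮 P).2 (h𝔮.1.2 hP)
  obtain ⟨hx0, -⟩ := (polarIdealK_le_ker_iff F (m + 1) (primePoint 𝔮)).1 hxle
  obtain ⟨I, hI, hspan⟩ := exists_row_basis
    (polarJac (fun a => toC (F a)) (m + 1) (genMat n _) (primePoint 𝔮))
  choose U hU using hspan
  obtain ⟨a₀, ha₀⟩ := exists_not_mem_of_polar hxle hI
  have hcard := card_le_trdeg_of_row_basis h𝔮 hI ha₀ (hU a₀)
  obtain ⟨k, z, hz, hk⟩ := exists_coord_algebraicIndependent 𝔮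
  rw [← hk] at hcard ⊢
  norm_cast at hcard ⊢
  have hIp : I.card < p := by
    simpa using Finset.card_lt_univ_of_notMem ha₀
  by_contra! hlt
  have hIp2 : I.card + 1 < p := by omega
  obtain ⟨a₁, ha₁, hne⟩ : ∃ a₁, a₁ ∉ I ∧ a₁ ≠ a₀ := by
    by_contra! h
    have : Finset.univ ⊆ insert a₀ I := fun a _ => by
      by_cases ha : a ∈ I
      · exact Finset.mem_insert_of_mem ha
      · exact Finset.mem_insert.2 (Or.inl (h a ha))
    have := (Finset.card_le_card this).trans (Finset.card_insert_le _ _)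
    simp at this
    omega
  have hα : Function.Injective (fun t : Bool => if t then a₀ else a₁) := by
    intro s t
    cases s <;> cases t <;> simp [hne, hne.symm]
  have := algebraicIndependent_card_le hsm hx0 (I := I) hα
    (by intro t; cases t <;> simp [ha₀, ha₁]) (fun t c => hU _ c) hn hz
  simp at this
  omega

/-- The map `K[X₁, …, X_m] → K[X] / 𝔮`. -/
def componentHom (𝔮 : Ideal (MvPolynomial (Fin n) (GenField n))) {m : ℕ} (hm : m ≤ n) :
    MvPolynomial (Fin m) (GenField n) →ₐ[GenField n] MvPolynomial (Fin n) (GenField n) ⧸ 𝔮 :=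
  (Ideal.Quotient.mkₐ (GenField n) 𝔮).comp (rename (Fin.castLE hm))

lemma isIntegral_componentHom
    (hsm : ∀ x : Fin n → ℂ, (∀ j, eval x (toC (F j)) = 0) →
      (jacEval (fun j => toC (F j)) x).rank = p)
    {m : ℕ} (hm : m ≤ n) {𝔮 : Ideal (MvPolynomial (Fin n) (GenField n))} (hp𝔮 : 𝔮.IsPrime)
    (h𝔮 : polarIdealK (fun a => genChange (F a)) (m + 1) ≤ 𝔮) :
    (componentHom 𝔮 hm).toRingHom.IsIntegral := by
  intro b
  obtain ⟨b, rfl⟩ := Ideal.Quotient.mk_surjective b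
  have hle := (hp𝔮.radical_le_iff).2 h𝔮
  exact (isIntegral_coordHom hsm hm (Ideal.Quotient.mk _ b)).map (Ideal.Quotient.factor hle)

theorem injective_componentHom
    (hsm : ∀ x : Fin n → ℂ, (∀ j, eval x (toC (F j)) = 0) →
      (jacEval (fun j => toC (F j)) x).rank = p)
    {m : ℕ} (hmp : m + p ≤ n) (hn : 0 < n) (hm : m ≤ n)
    {𝔮 : Ideal (MvPolynomial (Fin n) (GenField n))}
    (h𝔮 : 𝔮 ∈ (polarIdealK (fun a => genChange (F a)) (m + 1)).minimalPrimes) :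
    Function.Injective (componentHom 𝔮 hm) := by
  have hprime : 𝔮.IsPrime := h𝔮.1.1
  have h_int := isIntegral_componentHom hsm hm hprime h𝔮.1.2
  refine injective_of_isIntegral_of_le_trdeg (E := GenField n)
    (S := MvPolynomial (Fin n) (GenField n) ⧸ 𝔮) (componentHom 𝔮 hm) h_int ?_
  rw [← trdeg_fractionRing]
  exact le_trdeg_of_mem_minimalPrimes hsm hmp hn h𝔮

end Dimension

section MinimalPolynomials

lemma exists_monic_prime_dvd_iff {R S : Type*} [CommRing R] [IsDomain R] [IsIntegrallyClosed R]
    [CommRing S] [IsDomain S] (φ : R →+* S) (hφ : Function.Injective φ) {s : S}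
    (hs : φ.IsIntegralElem s) :
    ∃ P : Polynomial R, P.Monic ∧ Prime P ∧ ∀ q, q.eval₂ φ s = 0 ↔ P ∣ q := by
  let _ := φ.toAlgebra
  have : FaithfulSMul R S := (faithfulSMul_iff_algebraMap_injective R S).2 hφ
  have hs' : IsIntegral R s := hs
  refine ⟨minpoly R s, minpoly.monic hs', minpoly.prime_of_isIntegrallyClosed hs', fun q => ?_⟩
  refine ⟨fun hq => minpoly.isIntegrallyClosed_dvd hs' hq, ?_⟩
  rintro ⟨h, rfl⟩
  have : Polynomial.eval₂ φ s (minpoly R s) = 0 := minpoly.aeval R s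
  rw [Polynomial.eval₂_mul, this, zero_mul]

lemma exists_monic_forall_dvd_iff {R Λ : Type*} [CommRing R] (t : Finset Λ)
    (P : Λ → Polynomial R) (hm : ∀ l ∈ t, (P l).Monic) (hP : ∀ l ∈ t, Prime (P l)) :
    ∃ Q : Polynomial R, Q.Monic ∧ ∀ q, Q ∣ q ↔ ∀ l ∈ t, P l ∣ q := by
  classical
  induction t using Finset.induction_on with
  | empty => exact ⟨1, Polynomial.monic_one, by simp⟩
  | insert l t hl ih =>
    obtain ⟨Q, hQ, hdvd⟩ := ih (fun l h => hm l (Finset.mem_insert_of_mem h))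
      fun l h => hP l (Finset.mem_insert_of_mem h)
    have hPl := hP l (Finset.mem_insert_self l t)
    by_cases h : P l ∣ Q
    · refine ⟨Q, hQ, fun q => ?_⟩
      rw [Finset.forall_mem_insert, ← hdvd]
      exact ⟨fun hq => ⟨h.trans hq, hq⟩, fun hq => hq.2⟩
    · refine ⟨P l * Q, (hm l (Finset.mem_insert_self l t)).mul hQ, fun q => ?_⟩
      rw [Finset.forall_mem_insert, ← hdvd]
      refine ⟨fun hq => ⟨(dvd_mul_right _ _).trans hq, (dvd_mul_left _ _).trans hq⟩, ?_⟩
      rintro ⟨h1, ⟨r, rfl⟩⟩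
      rw [mul_comm]
      exact mul_dvd_mul_left _ ((hPl.dvd_or_dvd h1).resolve_left h)

/-- Over a localization of a factorial ring, every nonzero element has a primitive numerator. -/
lemma exists_primitive_numerator {B Q : Type*} [CommRing B] [IsDomain B]
    [UniqueFactorizationMonoid B] [CommRing Q] [IsDomain Q] (f : B →+* Q)
    (hf : Function.Injective f)
    (hloc : ∀ q : Q, ∃ D b : B, IsUnit (f D) ∧ f b = f D * q) {P : Q} (hP : P ≠ 0) :
    ∃ G : B, ∃ u : Q, IsUnit u ∧ f G = u * P ∧ ∀ b, P ∣ f b → G ∣ b := by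
  obtain ⟨D₀, b₀, hD₀, hb₀⟩ := hloc P
  obtain ⟨G, ⟨u, hu, hG⟩, hmin⟩ := (wellFounded_dvdNotUnit (α := B)).has_min
    {G | ∃ u : Q, IsUnit u ∧ f G = u * P} ⟨b₀, f D₀, hD₀, hb₀⟩
  refine ⟨G, u, hu, hG, fun b hb => ?_⟩
  have hG0 : G ≠ 0 := by
    rintro rfl
    rw [map_zero] at hG
    exact mul_ne_zero hu.ne_zero hP hG.symm
  obtain ⟨r, hr⟩ : f G ∣ f b := by
    rw [hG]
    exact (hu.mul_left_dvd).2 hb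
  obtain ⟨D, h, hD, hh⟩ := hloc r
  have hDb : D * b = G * h := hf (by rw [map_mul, map_mul, hr, hh]; ring)
  have hrel : IsRelPrime G D := by
    intro c hcG hcD
    by_contra hc
    obtain ⟨G', rfl⟩ := hcG
    have hcu : IsUnit (f c) := isUnit_of_dvd_unit (map_dvd f hcD) hD
    obtain ⟨v, hv⟩ := hcu.exists_left_inv
    refine hmin G' ⟨v * u, (IsUnit.of_mul_eq_one (f c) hv).mul hu, ?_⟩ ?_
    · rw [mul_assoc, ← hG, map_mul, ← mul_assoc, hv, one_mul]
    · exact ⟨right_ne_zero_of_mul hG0, c, hc, mul_comm _ _⟩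
  exact hrel.dvd_of_dvd_mul_left ⟨h, hDb⟩

end MinimalPolynomials

section Interpretation

variable (n m : ℕ)

/-- The interpretation homomorphism with `m` variables in the coefficients. -/
def interpHom : MvPolynomial ((Fin n × Fin n) ⊕ (Fin m ⊕ Unit)) ℂ →+*
    Polynomial (MvPolynomial (Fin m) (GenField n)) := interp n (m + 1)

/-- The identification of `ℂ[𝔄, X₁, …, X_m, T]` with `ℂ[𝔄][X₁, …, X_m][T]`. -/
def interpInt : MvPolynomial ((Fin n × Fin n) ⊕ (Fin m ⊕ Unit)) ℂ →ₐ[ℂ]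
    Polynomial (MvPolynomial (Fin m) (MvPolynomial (Fin n × Fin n) ℂ)) :=
  aeval (Sum.elim (fun km => Polynomial.C (C (X km)))
    (Sum.elim (fun t => Polynomial.C (X t)) fun _ => Polynomial.X))

/-- The coefficient map `ℂ[𝔄][X₁, …, X_m][T] → K[X₁, …, X_m][T]`. -/
def coeffMap : Polynomial (MvPolynomial (Fin m) (MvPolynomial (Fin n × Fin n) ℂ)) →+*
    Polynomial (MvPolynomial (Fin m) (GenField n)) :=
  Polynomial.mapRingHom (map (algebraMap (MvPolynomial (Fin n × Fin n) ℂ) (GenField n)))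

lemma interpHom_eq_coeffMap (b : MvPolynomial ((Fin n × Fin n) ⊕ (Fin m ⊕ Unit)) ℂ) :
    interpHom n m b = coeffMap n m (interpInt n m b) := by
  have h : interpHom n m = (coeffMap n m).comp (interpInt n m : _ →+* _) := by
    refine ringHom_ext (fun r => ?_) (fun s => ?_)
    · simp [interpHom, interp, coeffMap, interpInt,
        IsScalarTower.algebraMap_apply ℂ (MvPolynomial (Fin m) (MvPolynomial (Fin n × Fin n) ℂ))
          (Polynomial _), algebraMap_eq]
    · rcases s with s | s | s <;> simp [interpHom, interp, coeffMap, interpInt, genEntry]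
  exact congrArg (fun φ => φ b) h

lemma coeffMap_injective : Function.Injective (coeffMap n m) :=
  Polynomial.map_injective _ (map_injective _ (IsFractionRing.injective _ _))

lemma interpInt_bijective : Function.Bijective (interpInt n m) := by
  let g : Polynomial (MvPolynomial (Fin m) (MvPolynomial (Fin n × Fin n) ℂ)) →+*
      MvPolynomial ((Fin n × Fin n) ⊕ (Fin m ⊕ Unit)) ℂ :=
    Polynomial.eval₂RingHom (eval₂Hom (rename Sum.inl).toRingHom fun t => X (Sum.inr (Sum.inl t)))
      (X (Sum.inr (Sum.inr ())))
  have h1 : g.comp (interpInt n m : _ →+* _) = RingHom.id _ := by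
    refine ringHom_ext (fun r => ?_) (fun s => ?_)
    · simp [interpInt, g,
        IsScalarTower.algebraMap_apply ℂ (MvPolynomial (Fin m) (MvPolynomial (Fin n × Fin n) ℂ))
          (Polynomial _), algebraMap_eq]
    · rcases s with s | s | s <;> simp [interpInt, g]
  have h2 : (interpInt n m : _ →+* _).comp g = RingHom.id _ := by
    refine Polynomial.ringHom_ext' (ringHom_ext' (ringHom_ext (fun r => ?_) (fun s => ?_))
      fun s => ?_) ?_
    · simp [interpInt, g,
        IsScalarTower.algebraMap_apply ℂ (MvPolynomial (Fin m) (MvPolynomial (Fin n × Fin n) ℂ))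
          (Polynomial _), algebraMap_eq]
    · simp [interpInt, g]
    · simp [interpInt, g]
    · simp [interpInt, g]
  exact ⟨Function.LeftInverse.injective (g := g) fun b => congrArg (fun φ => φ b) h1,
    Function.RightInverse.surjective (g := g) fun b => congrArg (fun φ => φ b) h2⟩

lemma interpHom_injective : Function.Injective (interpHom n m) := by
  have : ⇑(interpHom n m) = coeffMap n m ∘ interpInt n m := funext (interpHom_eq_coeffMap n m)
  rw [this]
  exact (coeffMap_injective n m).comp (interpInt_bijective n m).1

lemma exists_interpHom_eq_mul (q : Polynomial (MvPolynomial (Fin m) (GenField n))) :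
    ∃ D b : MvPolynomial ((Fin n × Fin n) ⊕ (Fin m ⊕ Unit)) ℂ, IsUnit (interpHom n m D) ∧
      interpHom n m b = interpHom n m D * q := by
  let M := nonZeroDivisors (MvPolynomial (Fin n × Fin n) ℂ)
  let _ : Algebra (MvPolynomial (Fin m) (MvPolynomial (Fin n × Fin n) ℂ))
      (MvPolynomial (Fin m) (GenField n)) := MvPolynomial.algebraMvPolynomial
  let M₁ : Submonoid (MvPolynomial (Fin m) (MvPolynomial (Fin n × Fin n) ℂ)) := M.map C
  have h1 : IsLocalization M₁ (MvPolynomial (Fin m) (GenField n)) :=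
    MvPolynomial.isLocalization M (GenField n)
  let _ : Algebra (Polynomial (MvPolynomial (Fin m) (MvPolynomial (Fin n × Fin n) ℂ)))
      (Polynomial (MvPolynomial (Fin m) (GenField n))) :=
    Polynomial.algebra (R := MvPolynomial (Fin m) (MvPolynomial (Fin n × Fin n) ℂ))
      (A := MvPolynomial (Fin m) (GenField n))
  let M₂ : Submonoid (Polynomial (MvPolynomial (Fin m) (MvPolynomial (Fin n × Fin n) ℂ))) :=
    M₁.map Polynomial.C
  have h2 : IsLocalization M₂ (Polynomial (MvPolynomial (Fin m) (GenField n))) :=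
    Polynomial.isLocalization M₁ (MvPolynomial (Fin m) (GenField n))
  have hmap : ∀ r, algebraMap _ (Polynomial (MvPolynomial (Fin m) (GenField n))) r =
      coeffMap n m r := fun r => rfl
  obtain ⟨⟨b', D'⟩, hb'⟩ := IsLocalization.surj M₂ q
  have hu := IsLocalization.map_units (Polynomial (MvPolynomial (Fin m) (GenField n))) D'
  obtain ⟨b, rfl⟩ := (interpInt_bijective n m).2 b'
  obtain ⟨D, hD⟩ := (interpInt_bijective n m).2 D'.1
  simp only [hmap, ← hD, ← interpHom_eq_coeffMap] at hb' hu
  exact ⟨D, b, hu, by rw [← hb', mul_comm]⟩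

/-- An element of `ℂ[𝔄, X₁, …, X_m, T]` whose image is a unit multiple of a monic polynomial is,
up to a constant from `ℂ[𝔄]`, monic. -/
lemma exists_interpHom_eq_C_mul {G : MvPolynomial ((Fin n × Fin n) ⊕ (Fin m ⊕ Unit)) ℂ}
    {u P : Polynomial (MvPolynomial (Fin m) (GenField n))} (hu : IsUnit u) (hP : P.Monic)
    (hG : interpHom n m G = u * P) :
    ∃ D : MvPolynomial (Fin n × Fin n) ℂ, D ≠ 0 ∧ interpHom n m G =
      Polynomial.C (C (algebraMap (MvPolynomial (Fin n × Fin n) ℂ) (GenField n) D)) * P := by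
  obtain ⟨r, hr, rfl⟩ := Polynomial.isUnit_iff.1 hu
  obtain ⟨κ, hκ, rfl⟩ := MvPolynomial.isUnit_iff_eq_C_of_isReduced.1 hr
  have hlead := congrArg (fun q => (q.coeff P.natDegree).coeff 0) hG
  simp only [Polynomial.coeff_C_mul, hP.coeff_natDegree, mul_one, coeff_zero_C,
    interpHom_eq_coeffMap] at hlead
  rw [coeffMap, Polynomial.coe_mapRingHom, Polynomial.coeff_map, coeff_map] at hlead
  refine ⟨_, ?_, by rw [hG, hlead]⟩
  intro h0
  rw [h0, map_zero] at hlead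
  exact hκ.ne_zero hlead.symm

end Interpretation

section DegreeBound

/-- A normalized linear form over `ℂ` that vanishes at none of finitely many nonzero vectors. -/
lemma exists_form_ne_zero {p : ℕ} (a₀ : Fin p) (ha₀ : (a₀ : ℕ) = 0) {Λ : Type*} [Finite Λ]
    {L : Λ → Type*} [∀ l, Field (L l)] [∀ l, Algebra ℂ (L l)] {w : ∀ l, Fin p → L l}
    (hw : ∀ l, w l ≠ 0) :
    ∃ lam : Fin p → ℂ, lam a₀ = 1 ∧ ∀ l, ∑ a, algebraMap ℂ (L l) (lam a) * w l a ≠ 0 := by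
  classical
  let Q (l : Λ) : Polynomial (L l) := ∑ a, Polynomial.C (w l a) * Polynomial.X ^ (a : ℕ)
  have hQ (l : Λ) : Q l ≠ 0 := by
    obtain ⟨a, ha⟩ := Function.ne_iff.1 (hw l)
    intro h0
    have := congrArg (fun q => q.coeff (a : ℕ)) h0
    simp only [Q, Polynomial.finsetSum_coeff, Polynomial.coeff_C_mul, Polynomial.coeff_X_pow,
      Fin.val_inj, mul_ite, mul_one, mul_zero, Finset.sum_ite_eq, Finset.mem_univ, if_true,
      Polynomial.coeff_zero] at this
    exact ha this
  have hfin : (⋃ l, {t : ℂ | (Q l).eval (algebraMap ℂ (L l) t) = 0}).Finite := by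
    refine Set.finite_iUnion fun l => ?_
    refine ((Q l).roots.toFinset.finite_toSet.preimage
      (algebraMap ℂ (L l)).injective.injOn).subset fun t ht => ?_
    simpa [hQ l] using ht
  obtain ⟨t, ht⟩ := hfin.infinite_compl.nonempty
  refine ⟨fun a => t ^ (a : ℕ), by simp [ha₀], fun l h0 => ht ?_⟩
  refine Set.mem_iUnion.2 ⟨l, ?_⟩
  rw [Set.mem_ofPred_eq, Polynomial.eval_finsetSum, ← h0]
  refine Finset.sum_congr rfl fun a _ => ?_
  rw [Polynomial.eval_mul, Polynomial.eval_C, Polynomial.eval_pow, Polynomial.eval_X, map_pow,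
    mul_comm]

variable {n p : ℕ} {F : Fin p → MvPolynomial (Fin n) ℤ}

lemma le_of_polar_le
    (hsm : ∀ x : Fin n → ℂ, (∀ j, eval x (toC (F j)) = 0) →
      (jacEval (fun j => toC (F j)) x).rank = p)
    {i : ℕ} {𝔮 : Ideal (MvPolynomial (Fin n) (GenField n))} [𝔮.IsPrime]
    (hle : polarIdealK (fun a => genChange (F a)) i ≤ 𝔮) : p ≤ n := by
  obtain ⟨hx, -⟩ := (polarIdealK_le_ker_iff F i (primePoint 𝔮)).1
    fun P hP => (aeval_primePoint_eq_zero 𝔮 P).2 (hle hP)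
  have h := (linearIndependent_rows_of_forall
    (jacobian_rows_independent hsm hx)).fintype_card_le_finrank
  simpa using h

lemma aeval_genMat_eq_aeval_eval₂ {L : Type*} [Field L] [Algebra ℂ L] [Algebra (GenField n) L]
    [IsScalarTower ℂ (GenField n) L] {m : ℕ} (hm : m ≤ n) (x : Fin n → L) (j : Fin n)
    (b : MvPolynomial ((Fin n × Fin n) ⊕ (Fin m ⊕ Unit)) ℂ) :
    aeval (Sum.elim (genMat n L) (x ∘ Sum.elim (Fin.castLE hm) fun _ => j)) b =
      aeval x ((interpHom n m b).eval₂ (rename (Fin.castLE hm)).toRingHom (X j)) := by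
  let ψ : Polynomial (MvPolynomial (Fin m) (GenField n)) →+* MvPolynomial (Fin n) (GenField n) :=
    Polynomial.eval₂RingHom (rename (Fin.castLE hm)).toRingHom (X j)
  let φ : MvPolynomial ((Fin n × Fin n) ⊕ (Fin m ⊕ Unit)) ℂ →ₐ[ℂ] L :=
    aeval (Sum.elim (genMat n L) (x ∘ Sum.elim (Fin.castLE hm) fun _ => j))
  let χ : MvPolynomial (Fin n) (GenField n) →ₐ[GenField n] L := aeval x
  have h : φ.toRingHom = χ.toRingHom.comp (ψ.comp (interpHom n m)) := by
    refine ringHom_ext (fun r => ?_) (fun s => ?_)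
    · simp [φ, χ, ψ, interpHom, interp, IsScalarTower.algebraMap_apply ℂ (GenField n) L,
        IsScalarTower.algebraMap_apply ℂ (MvPolynomial (Fin n × Fin n) ℂ) (GenField n),
        algebraMap_eq]
    · rcases s with s | s | s <;> simp [φ, χ, ψ, interpHom, interp, genMat]
  exact congrArg (fun φ => φ b) h

lemma totalDegree_le_of_components {d : ℕ} (hp : 0 < p) (hd : 0 < d)
    (hdeg : ∀ j, (toC (F j)).totalDegree ≤ d)
    (hsm : ∀ x : Fin n → ℂ, (∀ j, eval x (toC (F j)) = 0) →
      (jacEval (fun j => toC (F j)) x).rank = p)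
    {m : ℕ} (hm : m < n) {Λ : Type} [Finite Λ] (𝔮 : Λ → Ideal (MvPolynomial (Fin n) (GenField n)))
    [∀ l, (𝔮 l).IsPrime] (hle : ∀ l, polarIdealK (fun a => genChange (F a)) (m + 1) ≤ 𝔮 l)
    (j : Fin n) (G : MvPolynomial ((Fin n × Fin n) ⊕ (Fin m ⊕ Unit)) ℂ)
    (hG : ∀ b, (∀ l, (interpHom n m b).eval₂ (componentHom (𝔮 l) hm.le).toRingHom
      (Ideal.Quotient.mk (𝔮 l) (X j)) = 0) → G ∣ b) :
    G.totalDegree ≤ (2 * d) ^ (p + (n - (m + 1))) := by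
  have hpt := fun l => (polarIdealK_le_ker_iff F (m + 1) (primePoint (𝔮 l))).1
    fun P hP => (aeval_primePoint_eq_zero (𝔮 l) P).2 (hle l hP)
  choose hx w hw hker using hpt
  obtain ⟨lam, hlam, hne⟩ := exists_form_ne_zero ⟨0, hp⟩ rfl hw
  have hinf (l : Λ) : Infinite (FractionRing (MvPolynomial (Fin n) (GenField n) ⧸ 𝔮 l)) :=
    Infinite.of_injective _ (algebraMap ℂ _).injective
  have hsmooth (l : Λ) := isSmoothZero_norm hsm (m + 1) hlam
    (w := fun a => (∑ a, algebraMap ℂ _ (lam a) * w l a)⁻¹ * w l a) (hx l)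
    (by
      simp only [mul_left_comm _ (_)⁻¹, ← Finset.mul_sum]
      exact inv_mul_cancel₀ (hne l))
    (fun c => by simp only [mul_assoc, ← Finset.mul_sum, hker, mul_zero])
  have hcard : Fintype.card (Fin p ⊕ (Unit × Fin (n - (m + 1)))) = p + (n - (m + 1)) := by simp
  have hcard' : Fintype.card {b : Fin p // b ≠ ⟨0, hp⟩} = p - 1 := by simp
  rw [← hcard]
  refine totalDegree_le_of_forall_dvd (by omega) ?_
    (totalDegree_polarSystemPoly_le hd hdeg (m + 1) _ _) hsmooth
    (Sum.map id (Sum.inl ∘ Sum.elim (Fin.castLE hm.le) fun _ => j)) G fun b hb => hG b fun l => ?_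
  · rw [hcard]
    simp only [Fintype.card_sum, Fintype.card_prod, Fintype.card_fin, Fintype.card_unit, hcard']
    omega
  · have h0 : aeval (primePoint (𝔮 l)) ((interpHom n m b).eval₂
        (rename (Fin.castLE hm.le)).toRingHom (X j)) = 0 := by
      rw [← aeval_genMat_eq_aeval_eval₂, ← hb l]
      congr 2
      funext s
      rcases s with s | s <;> rfl
    rw [aeval_primePoint_eq_zero, ← Ideal.Quotient.eq_zero_iff_mem, Polynomial.hom_eval₂] at h0
    exact h0

lemma exists_monic_eval₂_componentHom
    (hsm : ∀ x : Fin n → ℂ, (∀ j, eval x (toC (F j)) = 0) →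
      (jacEval (fun j => toC (F j)) x).rank = p)
    {m : ℕ} (hmp : p ≤ n → m + p ≤ n) (hn : 0 < n) (hm : m ≤ n)
    {𝔮 : Ideal (MvPolynomial (Fin n) (GenField n))}
    (h𝔮 : 𝔮 ∈ (polarIdealK (fun a => genChange (F a)) (m + 1)).minimalPrimes) (j : Fin n) :
    ∃ P : Polynomial (MvPolynomial (Fin m) (GenField n)), P.Monic ∧ Prime P ∧
      ∀ q : Polynomial (MvPolynomial (Fin m) (GenField n)),
        q.eval₂ (componentHom 𝔮 hm).toRingHom (Ideal.Quotient.mk 𝔮 (X j)) = 0 ↔ P ∣ q := by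
  have hprime : 𝔮.IsPrime := h𝔮.1.1
  have hinj : Function.Injective (componentHom 𝔮 hm) :=
    injective_componentHom hsm (hmp (le_of_polar_le hsm h𝔮.1.2)) hn hm h𝔮
  have h_int := isIntegral_componentHom hsm hm hprime h𝔮.1.2
  exact exists_monic_prime_dvd_iff (R := MvPolynomial (Fin m) (GenField n))
    (S := MvPolynomial (Fin n) (GenField n) ⧸ 𝔮) (componentHom 𝔮 hm).toRingHom hinj (h_int _)

theorem exists_monic_mem_radical {d : ℕ} (hp : 0 < p) (hd : 0 < d)
    (hdeg : ∀ j, (toC (F j)).totalDegree ≤ d)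
    (hsm : ∀ x : Fin n → ℂ, (∀ j, eval x (toC (F j)) = 0) →
      (jacEval (fun j => toC (F j)) x).rank = p)
    {m : ℕ} (hm : m < n) (hmp : p ≤ n → m + p ≤ n) (j : Fin n) :
    ∃ P : Polynomial (MvPolynomial (Fin m) (GenField n)), P.Monic ∧
      P.eval₂ (rename (Fin.castLE hm.le)).toRingHom (X j) ∈
        (polarIdealK (fun a => genChange (F a)) (m + 1)).radical ∧
      ∃ (D : MvPolynomial (Fin n × Fin n) ℂ)
        (G : MvPolynomial ((Fin n × Fin n) ⊕ (Fin m ⊕ Unit)) ℂ), D ≠ 0 ∧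
        G.totalDegree ≤ (2 * d) ^ (p + (n - (m + 1))) ∧ interpHom n m G =
          Polynomial.C (C (algebraMap (MvPolynomial (Fin n × Fin n) ℂ) (GenField n) D)) * P := by
  have hn : 0 < n := by omega
  set 𝒦 := polarIdealK (fun a => genChange (F a)) (m + 1) with h𝒦
  have hfin : 𝒦.minimalPrimes.Finite := Ideal.finite_minimalPrimes_of_isNoetherianRing _ 𝒦
  have := hfin.fintype
  have hprime (l : 𝒦.minimalPrimes) : l.1.IsPrime := l.2.1.1
  have hmin (l : 𝒦.minimalPrimes) := exists_monic_eval₂_componentHom hsm hmp hn hm.le l.2 j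
  choose Q hQm hQp hQ using hmin
  obtain ⟨P, hP, hdvd⟩ := exists_monic_forall_dvd_iff Finset.univ Q (fun l _ => hQm l)
    fun l _ => hQp l
  obtain ⟨G, u, hu, hG, hGdvd⟩ := exists_primitive_numerator (interpHom n m)
    (interpHom_injective n m) (exists_interpHom_eq_mul n m) hP.ne_zero
  obtain ⟨D, hD, hGD⟩ := exists_interpHom_eq_C_mul n m hu hP hG
  refine ⟨P, hP, ?_, D, G, hD, ?_, hGD⟩
  · rw [← Ideal.sInf_minimalPrimes, Submodule.mem_sInf]
    intro 𝔮 h𝔮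
    have h := (hQ ⟨𝔮, h𝔮⟩ P).2 ((hdvd P).1 dvd_rfl _ (Finset.mem_univ _))
    rw [← Ideal.Quotient.eq_zero_iff_mem, Polynomial.hom_eval₂]
    exact h
  · refine totalDegree_le_of_components hp hd hdeg hsm hm (fun l : 𝒦.minimalPrimes => l.1)
      (fun l => l.2.1.2) j G fun b hb => hGdvd b ((hdvd _).2 fun l _ => (hQ l _).1 (hb l))

end DegreeBound

/-- with `𝒦 = ⟨𝔍(i, F^𝔄)⟩ ⊆ K[X₁,…,X_n]`, for every `j ∈ {i,…,n}` there
is `P_j ∈ K[X₁,…,X_{i−1},X_j]`, monic in `X_j`, with `P_j ∈ √𝒦`, and a nonzero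
denominator `D ∈ ℂ[𝔄_{k,m}]` such that `D·P_j` is a polynomial in
`ℂ[𝔄_{k,m}, X₁,…,X_{i−1}, X_j]` of total degree at most `(2d)^{2n}`. -/
theorem generic_polar_noether_degree_bound
    (n p d : ℕ) (hn : 0 < n) (hp : 0 < p) (hd : 0 < d)
    (F : Fin p → MvPolynomial (Fin n) ℤ)
    (hdeg : ∀ j, (toC (F j)).totalDegree ≤ d)
    (hrad : (Ideal.span (Set.range fun j => toC (F j))).IsRadical)
    (hequi : ∀ P ∈ (Ideal.span (Set.range fun j => toC (F j))).minimalPrimes,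
      IdealHeightEq P p)
    (hsm : ∀ x : Fin n → ℂ, (∀ j, eval x (toC (F j)) = 0) →
      (jacEval (fun j => toC (F j)) x).rank = p)
    (i : ℕ) (hi1 : 1 ≤ i) (hi2 : i ≤ n - p + 1) :
    ∀ j : Fin n, i - 1 ≤ (j : ℕ) →
      ∃ P : Polynomial (MvPolynomial (Fin (i - 1)) (GenField n)),
        P.Monic ∧
        Polynomial.eval₂
          ((rename (Fin.castLE (show i - 1 ≤ n by omega) : Fin (i - 1) → Fin n)).toRingHom :
            MvPolynomial (Fin (i - 1)) (GenField n) →+* MvPolynomial (Fin n) (GenField n))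
          (X j) P
          ∈ (polarIdealK (fun j => genChange (F j)) i).radical ∧
        ∃ (D : MvPolynomial (Fin n × Fin n) ℂ)
          (Pbar : MvPolynomial ((Fin n × Fin n) ⊕ (Fin (i - 1) ⊕ Unit)) ℂ),
          D ≠ 0 ∧
          Pbar.totalDegree ≤ (2 * d) ^ (2 * n) ∧
          interp n i Pbar =
            Polynomial.C (C (algebraMap (MvPolynomial (Fin n × Fin n) ℂ) (GenField n) D))
              * P := by
  intro j _
  obtain ⟨m, rfl⟩ : ∃ m, i = m + 1 := ⟨i - 1, by omega⟩
  have hm : m < n := by omega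
  by_cases hpn : p ≤ n
  · obtain ⟨P, hP, hrad, D, G, hD, hG, hGD⟩ :=
      exists_monic_mem_radical hp hd hdeg hsm hm (fun _ => by omega) j
    exact ⟨P, hP, hrad, D, G, hD,
      hG.trans (Nat.pow_le_pow_right (by omega) (by omega)), hGD⟩
  · have htop : polarIdealK (fun j => genChange (F j)) (m + 1) = ⊤ := by
      by_contra hne
      obtain ⟨𝔮, h𝔮, hle⟩ := Ideal.exists_le_maximal _ hne
      have := h𝔮.isPrime
      exact hpn (le_of_polar_le hsm hle)
    exact ⟨1, Polynomial.monic_one, by simp [htop, Ideal.radical_top], 1, 1, one_ne_zero,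
      by simp, by simp⟩

end
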